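/- arXiv:1507.03293 — 2 statements merged into one kernel-verified Lean document; each statement's English description precedes it below -/
import Mathlib

section
/- Let a ∈ ℝ, let 0 < β̲ ≤ β̄, 0 < η̲ ≤ η̄, ν̄ > 0, and let h : ℝ → ℝ be bounded and measurable. Suppose H is convex on [0, ∞) and its derivative H′ is convex on (0, c) and concave on (c, ∞) for some 0 ≤ c ≤ ∞. Then the optimal value of ÕPT(𝒫⁺) equals the optimal value of ÕPT(𝒫₂⁺); that is, the supremum of ν̄ E_P[H(X)] over Borel probability measures P on [0, ∞) with μ̲ ≤ E_P[X] ≤ μ̄ and σ̲ ≤ E_P[X²] ≤ σ̄ equals the supremum of the same quantity over such measures supported on at most 2 points. -/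
open MeasureTheory Set Filter Topology

/-- `H(x) = ∫₀ˣ ∫₀ᵘ h(v + a) dv du`. -/
noncomputable def Hfun (a : ℝ) (h : ℝ → ℝ) (x : ℝ) : ℝ :=
  ∫ u in (0:ℝ)..x, (∫ v in (0:ℝ)..u, h (v + a))

/-- `P` is a Borel probability measure on `[0, ∞)` (modelled as a measure on `ℝ`
concentrated on `[0, ∞)`) with first moment in `[μ̲, μ̄]` and second moment in
`[σ̲, σ̄]`. -/
def RMomFeasible (μl μu σl σu : ℝ) (P : Measure ℝ) : Prop :=
  IsProbabilityMeasure P ∧ P (Set.Iio 0) = 0 ∧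
  Integrable (fun x => x) P ∧ Integrable (fun x => x ^ 2) P ∧
  μl ≤ (∫ x, x ∂P) ∧ (∫ x, x ∂P) ≤ μu ∧
  σl ≤ (∫ x, x ^ 2 ∂P) ∧ (∫ x, x ^ 2 ∂P) ≤ σu

/-- The measure `P` is supported on at most `n` points. -/
def SuppAtMost (n : ℕ) (P : Measure ℝ) : Prop :=
  ∃ s : Finset ℝ, s.card ≤ n ∧ P ((s : Set ℝ)ᶜ) = 0

lemma aux_conv3 {S : Set ℝ} {f : ℝ → ℝ} (hf : ConvexOn ℝ S f) {x y z : ℝ} (hx : x ∈ S)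
    (hz : z ∈ S) (hxy : x < y) (hyz : y < z) :
    (z - x) * f y ≤ (z - y) * f x + (y - x) * f z := by
  have h := hf.slope_mono_adjacent hx hz hxy hyz
  rw [div_le_div_iff₀ (by linarith) (by linarith)] at h
  nlinarith

lemma aux_sconv3 {S : Set ℝ} {f : ℝ → ℝ} (hf : StrictConvexOn ℝ S f) {x y z : ℝ} (hx : x ∈ S)
    (hz : z ∈ S) (hxy : x < y) (hyz : y < z) :
    (z - x) * f y < (z - y) * f x + (y - x) * f z := by
  have h := hf.slope_strict_mono_adjacent hx hz hxy hyz
  rw [div_lt_div_iff₀ (by linarith) (by linarith)] at h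
  nlinarith

lemma aux_conc3 {S : Set ℝ} {f : ℝ → ℝ} (hf : ConcaveOn ℝ S f) {x y z : ℝ} (hx : x ∈ S)
    (hz : z ∈ S) (hxy : x < y) (hyz : y < z) :
    (z - y) * f x + (y - x) * f z ≤ (z - x) * f y := by
  have h := hf.slope_anti_adjacent hx hz hxy hyz
  rw [div_le_div_iff₀ (by linarith) (by linarith)] at h
  nlinarith

lemma aux_sconc3 {S : Set ℝ} {f : ℝ → ℝ} (hf : StrictConcaveOn ℝ S f) {x y z : ℝ} (hx : x ∈ S)
    (hz : z ∈ S) (hxy : x < y) (hyz : y < z) :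
    (z - y) * f x + (y - x) * f z < (z - x) * f y := by
  have h := hf.slope_anti_adjacent hx hz hxy hyz
  rw [div_lt_div_iff₀ (by linarith) (by linarith)] at h
  nlinarith

lemma aux_mono {D f : ℝ → ℝ} (hD : ∀ x, HasDerivAt D (f x) x) {p q : ℝ} (hpq : p ≤ q)
    (hf : ∀ x, p < x → x < q → 0 ≤ f x) : D p ≤ D q := by
  refine monotoneOn_of_deriv_nonneg (convex_Icc p q)
    (fun x _ => (hD x).continuousAt.continuousWithinAt)
    (fun x _ => (hD x).differentiableAt.differentiableWithinAt) ?_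
    (left_mem_Icc.2 hpq) (right_mem_Icc.2 hpq) hpq
  intro x hx
  rw [interior_Icc] at hx
  rw [(hD x).deriv]
  exact hf x hx.1 hx.2

lemma aux_anti {D f : ℝ → ℝ} (hD : ∀ x, HasDerivAt D (f x) x) {p q : ℝ} (hpq : p ≤ q)
    (hf : ∀ x, p < x → x < q → f x ≤ 0) : D q ≤ D p := by
  have := aux_mono (D := fun x => - D x) (f := fun x => - f x) (fun x => (hD x).neg) hpq
    (fun x h1 h2 => by have := hf x h1 h2; linarith)
  linarith

lemma aux_core {D f : ℝ → ℝ} (hD : ∀ x, HasDerivAt D (f x) x) {c : ℝ} (hc : 0 ≤ c)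
    (hconc : StrictConcaveOn ℝ (Icc 0 c) f) (hconv : StrictConvexOn ℝ (Ici c) f)
    {x1 x2 : ℝ} (h0 : 0 ≤ x1) (h12 : x1 < x2) (hD1 : D x1 = 0) (hD2 : D x2 = 0)
    (hf2 : f x2 = 0) (hf1 : 0 ≤ f x1) (hf1' : 0 < x1 → f x1 = 0) :
    ∀ x, 0 ≤ x → 0 ≤ D x := by
  obtain ⟨y, ⟨hy1, hy2⟩, hy⟩ := exists_hasDerivAt_eq_zero h12
    (fun x _ => (hD x).continuousAt.continuousWithinAt) (by rw [hD1, hD2])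
    (fun x _ => hD x)
  -- not all three points in the concave region
  have hcx2 : c < x2 := by
    by_contra hh
    push Not at hh
    have := aux_sconc3 hconc (x := x1) (y := y) (z := x2) ⟨h0, by linarith⟩
      ⟨by linarith, hh⟩ hy1 hy2
    rw [hy, hf2] at this
    nlinarith
  have hx1c : 0 < x1 → x1 < c := by
    intro hp
    by_contra hh
    push Not at hh
    have := aux_sconv3 hconv (x := x1) (y := y) (z := x2) hh hcx2.le hy1 hy2
    rw [hy, hf2, hf1' hp] at this
    nlinarith
  have hx1c' : x1 ≤ c := by
    rcases h0.eq_or_lt with e | e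
    · rw [← e]; exact hc
    · exact (hx1c e).le
  have concv := hconc.concaveOn
  have convx := hconv.convexOn
  -- sign of f at c
  have S : (∀ x, 0 ≤ x → x < x1 → f x ≤ 0) ∧ (∀ x, x1 < x → x < y → 0 ≤ f x) ∧
      (∀ x, y < x → x < x2 → f x ≤ 0) ∧ (∀ x, x2 < x → 0 ≤ f x) := by
    rcases le_or_gt y c with hyc | hyc
    · have A2 : ∀ x, y < x → x ≤ c → f x ≤ 0 := by
        intro x hx hxc
        have := aux_conc3 concv (x := x1) (y := y) (z := x) ⟨h0, by linarith⟩
          ⟨by linarith, hxc⟩ hy1 hx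
        rw [hy] at this
        by_contra hh
        push Not at hh
        nlinarith [mul_nonneg (sub_nonneg.2 hx.le) hf1, mul_pos (sub_pos.2 hy1) hh]
      have fc : f c ≤ 0 := by
        rcases hyc.eq_or_lt with e | e
        · rw [← e, hy]
        · exact A2 c e le_rfl
      refine ⟨?_, ?_, ?_, ?_⟩
      · intro x hx0 hx
        have hp : 0 < x1 := by linarith
        have := aux_conc3 concv (x := x) (y := x1) (z := y) ⟨hx0, by linarith⟩
          ⟨by linarith, hyc⟩ hx hy1
        rw [hy, hf1' hp] at this
        by_contra hh
        push Not at hh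
        nlinarith [mul_pos (sub_pos.2 hy1) hh]
      · intro x hx hxy
        have := aux_conc3 concv (x := x1) (y := x) (z := y) ⟨h0, by linarith⟩
          ⟨by linarith, hyc⟩ hx hxy
        rw [hy] at this
        by_contra hh
        push Not at hh
        nlinarith [mul_pos_of_neg_of_neg (sub_neg.2 hy1) hh, mul_nonneg (sub_nonneg.2 hxy.le) hf1]
      · intro x hx hx2
        rcases le_or_gt x c with e | e
        · exact A2 x hx e
        · have := aux_conv3 convx (x := c) (y := x) (z := x2) self_mem_Ici hcx2.le e hx2
          rw [hf2] at this
          by_contra hh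
          push Not at hh
          nlinarith [mul_pos (sub_pos.2 hcx2) hh, mul_nonneg (sub_nonneg.2 hx2.le) (neg_nonneg.2 fc)]
      · intro x hx
        have := aux_conv3 convx (x := c) (y := x2) (z := x) self_mem_Ici
          (show c ≤ x by linarith) hcx2 hx
        rw [hf2] at this
        by_contra hh
        push Not at hh
        nlinarith [mul_pos_of_neg_of_neg (sub_neg.2 hcx2) hh,
          mul_nonneg (sub_nonneg.2 hx.le) (neg_nonneg.2 fc)]
    · have A2 : ∀ x, c ≤ x → x < y → 0 ≤ f x := by
        intro x hx hxy
        have := aux_conv3 convx (x := x) (y := y) (z := x2) hx hcx2.le hxy hy2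
        rw [hy, hf2] at this
        by_contra hh
        push Not at hh
        nlinarith [mul_pos_of_neg_of_neg (sub_neg.2 hy2) hh]
      have fc : 0 ≤ f c := A2 c le_rfl hyc
      refine ⟨?_, ?_, ?_, ?_⟩
      · intro x hx0 hx
        have hp : 0 < x1 := by linarith
        have hxc := hx1c hp
        have := aux_conc3 concv (x := x) (y := x1) (z := c) ⟨hx0, by linarith⟩
          ⟨hc, le_rfl⟩ hx hxc
        rw [hf1' hp] at this
        by_contra hh
        push Not at hh
        nlinarith [mul_pos (sub_pos.2 hxc) hh, mul_nonneg (sub_nonneg.2 hx.le) fc]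
      · intro x hx hxy
        rcases le_or_gt c x with e | e
        · exact A2 x e hxy
        · have := aux_conc3 concv (x := x1) (y := x) (z := c) ⟨h0, hx1c'⟩
            ⟨hc, le_rfl⟩ hx e
          by_contra hh
          push Not at hh
          nlinarith [mul_pos_of_neg_of_neg (sub_neg.2 (hx.trans e)) hh,
            mul_nonneg (sub_nonneg.2 hx.le) fc, mul_nonneg (sub_nonneg.2 e.le) hf1]
      · intro x hx hx2
        have := aux_conv3 convx (x := y) (y := x) (z := x2) hyc.le hcx2.le hx hx2
        rw [hf2, hy] at this
        by_contra hh
        push Not at hh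
        nlinarith [mul_pos (sub_pos.2 hy2) hh]
      · intro x hx
        have := aux_conv3 convx (x := y) (y := x2) (z := x) hyc.le
          (show c ≤ x by linarith) hy2 hx
        rw [hf2, hy] at this
        by_contra hh
        push Not at hh
        nlinarith [mul_pos_of_neg_of_neg (sub_neg.2 hy2) hh]
  obtain ⟨S1, S2, S3, S4⟩ := S
  intro x hx
  rcases lt_or_ge x x1 with e | e
  · rw [← hD1]
    exact aux_anti hD e.le (fun z hz hz' => S1 z (by linarith) hz')
  rcases le_or_gt x y with e' | e'
  · rw [← hD1]
    exact aux_mono hD e (fun z hz hz' => S2 z hz (by linarith))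
  rcases le_or_gt x x2 with e2 | e2
  · rw [← hD2]
    exact aux_anti hD e2 (fun z hz hz' => S3 z (by linarith) hz')
  · rw [← hD2]
    exact aux_mono hD e2.le (fun z hz hz' => S4 z hz)

/-- the two point functional -/
noncomputable def twoPt (m v : ℝ) (G : ℝ → ℝ) (t : ℝ) : ℝ :=
  (v * G (m - t) + t ^ 2 * G (m + v / t)) / (v + t ^ 2)

lemma aux_opt {G g : ℝ → ℝ} (hG : ∀ x, HasDerivAt G (g x) x)
    (hGc : ConvexOn ℝ (Ici 0) G) {K : ℝ} (hG0 : ∀ x, 0 ≤ x → 0 ≤ G x)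
    (hGK : ∀ x, 0 ≤ x → G x ≤ K * x) {c : ℝ} (hc : 0 ≤ c)
    (hconv : StrictConvexOn ℝ (Icc 0 c) g) (hconc : StrictConcaveOn ℝ (Ici c) g)
    {m v : ℝ} (hm : 0 < m) (hv : 0 < v) :
    ∃ t, 0 < t ∧ t ≤ m ∧ ∃ A B C : ℝ, (∀ x, 0 ≤ x → G x ≤ A + B * x + C * x ^ 2) ∧
      A + B * m + C * (v + m ^ 2) = twoPt m v G t := by
  have hGcont : Continuous G := continuous_iff_continuousAt.2 fun x => (hG x).continuousAt
  -- continuity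
  have hcont : ContinuousOn (twoPt m v G) (Icc 0 m) := by
    unfold twoPt
    refine ContinuousOn.div ?_ (by fun_prop) (fun t _ => by positivity)
    refine ContinuousOn.add (by fun_prop) ?_
    intro t ht
    rcases ht.1.eq_or_lt with e | e
    · subst e
      unfold ContinuousWithinAt
      have hlim : Tendsto (fun t : ℝ => K * m * t ^ 2 + K * v * t) (𝓝[Icc 0 m] 0) (𝓝 0) := by
        have : Continuous (fun t : ℝ => K * m * t ^ 2 + K * v * t) := by fun_prop
        have := (this.tendsto 0).mono_left (nhdsWithin_le_nhds (s := Icc 0 m))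
        simpa using this
      have e0 : (0:ℝ) ^ 2 * G (m + v / 0) = 0 := by simp
      simp only [e0]
      refine tendsto_of_tendsto_of_tendsto_of_le_of_le' tendsto_const_nhds hlim ?_ ?_
      · filter_upwards [self_mem_nhdsWithin] with t ht
        have : 0 ≤ v / t := div_nonneg hv.le ht.1
        have := hG0 (m + v / t) (by linarith)
        positivity
      · filter_upwards [self_mem_nhdsWithin] with t ht
        rcases ht.1.eq_or_lt with e | e
        · rw [← e]; simp
        · have h1 : 0 ≤ v / t := div_nonneg hv.le ht.1
          have h2 := mul_le_mul_of_nonneg_left (hGK (m + v / t) (by linarith)) (sq_nonneg t)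
          refine h2.trans (le_of_eq ?_)
          field_simp
    · refine ContinuousAt.continuousWithinAt ?_
      have : ContinuousAt (fun t => m + v / t) t := by
        refine continuousAt_const.add (continuousAt_const.div continuousAt_id e.ne')
      exact (by fun_prop : ContinuousAt (fun t : ℝ => t ^ 2) t).mul (hGcont.continuousAt.comp this)
  obtain ⟨t0, ht0, hmax0⟩ := isCompact_Icc.exists_isMaxOn (nonempty_Icc.2 hm.le) hcont
  have hjen : ∀ t, 0 < t → t ≤ m → G m ≤ twoPt m v G t := by
    intro t ht htm
    have hvt : 0 < v / t := div_pos hv ht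
    have := hGc.2 (show m - t ∈ Ici 0 from mem_Ici.2 (by linarith))
      (show m + v / t ∈ Ici 0 from mem_Ici.2 (by linarith))
      (show 0 ≤ v / (v + t ^ 2) by positivity) (show 0 ≤ t ^ 2 / (v + t ^ 2) by positivity)
      (by field_simp)
    have e : (v / (v + t ^ 2)) • (m - t) + (t ^ 2 / (v + t ^ 2)) • (m + v / t) = m := by
      simp only [smul_eq_mul]; field_simp; ring
    rw [e] at this
    refine this.trans (le_of_eq ?_)
    simp only [smul_eq_mul, twoPt]; ring
  obtain ⟨t, ht, htm, hmax⟩ : ∃ t, 0 < t ∧ t ≤ m ∧ ∀ r, 0 < r → r ≤ m →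
      twoPt m v G r ≤ twoPt m v G t := by
    rcases ht0.1.eq_or_lt with e | e
    · refine ⟨m, hm, le_rfl, fun r hr hrm => ?_⟩
      refine (hmax0 ⟨hr.le, hrm⟩).trans ?_
      rw [← e]
      have : twoPt m v G 0 = G m := by simp [twoPt]; field_simp
      rw [this]
      exact hjen m hm le_rfl
    · exact ⟨t0, e, ht0.2, fun r hr hrm => hmax0 ⟨hr.le, hrm⟩⟩
  have hvt : 0 < v / t := div_pos hv ht
  set x1 := m - t with hx1
  set x2 := m + v / t with hx2
  have h12 : x1 < x2 := by linarith
  -- quadratic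
  set C := (G x1 - G x2 - g x2 * (x1 - x2)) / (x1 - x2) ^ 2 with hC
  have hCe : C * (x1 - x2) ^ 2 = G x1 - G x2 - g x2 * (x1 - x2) := by
    rw [hC]; exact div_mul_cancel₀ _ (pow_ne_zero 2 (by linarith [h12]))
  set A := G x2 - g x2 * x2 + C * x2 ^ 2 with hA
  set B := g x2 - 2 * C * x2 with hB
  set D : ℝ → ℝ := fun x => A + B * x + C * x ^ 2 - G x with hDdef
  set f : ℝ → ℝ := fun x => B + C * (2 * x) - g x with hf
  have hD : ∀ x, HasDerivAt D (f x) x := by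
    intro x
    have h1 := ((((hasDerivAt_id x).const_mul B).const_add A).add
      (((hasDerivAt_id x).pow 2).const_mul C)).sub (hG x)
    refine h1.congr_deriv ?_
    simp only [hf, id]
    norm_num
  have hD1 : D x1 = 0 := by
    simp only [hDdef, hA, hB]; linear_combination hCe
  have hD2 : D x2 = 0 := by
    simp only [hDdef, hA, hB]; ring
  have hf2 : f x2 = 0 := by
    simp only [hf, hB]; ring
  have hval : ∀ r, 0 < r → twoPt m v (fun x => A + B * x + C * x ^ 2) r
      = A + B * m + C * (v + m ^ 2) := by
    intro r hr
    unfold twoPt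
    field_simp
    ring
  have hvt2 : A + B * m + C * (v + m ^ 2) = twoPt m v G t := by
    rw [← hval t ht]
    unfold twoPt
    rw [← hx1, ← hx2]
    have e1 : A + B * x1 + C * x1 ^ 2 = G x1 := by have := hD1; simp only [hDdef] at this; linarith
    have e2 : A + B * x2 + C * x2 ^ 2 = G x2 := by have := hD2; simp only [hDdef] at this; linarith
    simp only [e1, e2]
  -- derivative
  set Ψ : ℝ → ℝ := fun r => v * D (m - r) + r ^ 2 * D (m + v / r) with hΨ
  have hΨnn : ∀ r, 0 < r → r ≤ m → 0 ≤ Ψ r := by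
    intro r hr hrm
    have h1 := hmax r hr hrm
    rw [← hvt2, ← hval r hr] at h1
    unfold twoPt at h1
    rw [div_le_div_iff_of_pos_right (by positivity)] at h1
    simp only [hΨ, hDdef]
    nlinarith
  have hΨt : Ψ t = 0 := by
    simp only [hΨ]; rw [← hx1, ← hx2, hD1, hD2]; ring
  have hΨd : HasDerivAt Ψ (-(v * f x1)) t := by
    have d1 : HasDerivAt (fun r => D (m - r)) (f x1 * (-1)) t :=
      HasDerivAt.comp (h₂ := D) (h := fun r => m - r) t (hD x1) ((hasDerivAt_id t).const_sub m)
    have d0 : HasDerivAt (fun r => m + v / r) (-(v / t ^ 2)) t := by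
      have := ((hasDerivAt_inv ht.ne').const_mul v).const_add m
      refine this.congr_deriv ?_
      rw [mul_neg, div_eq_mul_inv]
    have d2 : HasDerivAt (fun r => D (m + v / r)) (f x2 * (-(v / t ^ 2))) t :=
      HasDerivAt.comp (h₂ := D) (h := fun r => m + v / r) t (hD x2) d0
    have := (d1.const_mul v).add (((hasDerivAt_id t).pow 2).mul d2)
    refine this.congr_deriv ?_
    rw [← hx2, hf2, hD2]
    simp
  have hf1 : 0 ≤ f x1 := by
    by_contra hneg
    push Not at hneg
    have hpos : 0 < -(v * f x1) := by nlinarith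
    -- slope positive so Ψ negative to the left
    have hs := hasDerivAt_iff_tendsto_slope.1 hΨd
    have hs' := hs.mono_left (nhdsWithin_mono t (s := Iio t) (fun x hx => ne_of_lt hx))
    have ev := hs'.eventually (lt_mem_nhds hpos)
    have ev2 : ∀ᶠ r in 𝓝[<] t, r ∈ Ioo 0 t := Ioo_mem_nhdsLT ht
    obtain ⟨r, hr1, hr2⟩ := (ev.and ev2).exists
    rw [slope_def_field, hΨt] at hr1
    have h3 := hΨnn r hr2.1 (by linarith [hr2.2])
    have : (Ψ r - 0) / (r - t) ≤ 0 :=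
      div_nonpos_of_nonneg_of_nonpos (by linarith) (by linarith [hr2.2])
    linarith
  have hf1' : 0 < x1 → f x1 = 0 := by
    intro hp
    have hloc : IsLocalMin Ψ t := by
      have : Ioo 0 m ∈ 𝓝 t := Ioo_mem_nhds ht (by linarith)
      filter_upwards [this] with r hr
      rw [hΨt]
      exact hΨnn r hr.1 hr.2.le
    have := hloc.hasDerivAt_eq_zero hΨd
    have : v * f x1 = 0 := by linarith
    exact (mul_eq_zero.1 this).resolve_left hv.ne'
  have hlin : ∀ s : Set ℝ, Convex ℝ s → ConvexOn ℝ s (fun x => B + C * (2 * x)) ∧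
      ConcaveOn ℝ s (fun x => B + C * (2 * x)) := by
    intro s hs
    constructor
    · refine ⟨hs, fun x _ y _ a b _ _ hab => le_of_eq ?_⟩
      simp only [smul_eq_mul]; linear_combination (-B) * hab
    · refine ⟨hs, fun x _ y _ a b _ _ hab => le_of_eq ?_⟩
      simp only [smul_eq_mul]; linear_combination (B) * hab
  have hfconc : StrictConcaveOn ℝ (Icc 0 c) f := by
    have := (hlin _ (convex_Icc 0 c)).2.sub_strictConvexOn hconv
    exact this
  have hfconv : StrictConvexOn ℝ (Ici c) f := by
    have := (hlin _ (convex_Ici c)).1.sub_strictConcaveOn hconc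
    exact this
  have hfin := aux_core hD hc hfconc hfconv (by linarith) h12 hD1 hD2 hf2 hf1 hf1'
  refine ⟨t, ht, htm, A, B, C, fun x hx => ?_, hvt2⟩
  have := hfin x hx
  simp only [hDdef] at this
  linarith

lemma aux_closure {s : Set ℝ} {f : ℝ → ℝ} (hf : ConvexOn ℝ s f) (hc : Continuous f) :
    ConvexOn ℝ (closure s) f := by
  refine ⟨hf.1.closure, fun x hx y hy a b ha hb hab => ?_⟩
  have hcl : IsClosed {p : ℝ × ℝ | f (a • p.1 + b • p.2) ≤ a • f p.1 + b • f p.2} :=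
    isClosed_le (by fun_prop) (by fun_prop)
  have hsub : s ×ˢ s ⊆ {p : ℝ × ℝ | f (a • p.1 + b • p.2) ≤ a • f p.1 + b • f p.2} :=
    fun p hp => hf.2 hp.1 hp.2 ha hb hab
  have h1 := closure_minimal hsub hcl
  rw [closure_prod_eq] at h1
  exact h1 (show (x, y) ∈ closure s ×ˢ closure s from ⟨hx, hy⟩)

lemma aux_closure' {s : Set ℝ} {f : ℝ → ℝ} (hf : ConcaveOn ℝ s f) (hc : Continuous f) :
    ConcaveOn ℝ (closure s) f := by
  have := (aux_closure hf.neg hc.neg).neg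
  simpa using this

lemma aux_convIcc {f : ℝ → ℝ} (hc : Continuous f) {c : ℝ} (h0 : 0 ≤ c)
    (hf : ConvexOn ℝ (Ioo 0 c) f) : ConvexOn ℝ (Icc 0 c) f := by
  rcases h0.eq_or_lt with e | e
  · subst e
    refine ⟨convex_Icc 0 0, fun x hx y hy a b ha hb hab => le_of_eq ?_⟩
    have hx0 : x = 0 := le_antisymm hx.2 hx.1
    have hy0 : y = 0 := le_antisymm hy.2 hy.1
    subst hx0; subst hy0
    simp only [smul_eq_mul, mul_zero, add_zero]
    linear_combination (-f 0) * hab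
  · have := aux_closure hf hc
    rwa [closure_Ioo e.ne] at this

lemma aux_concIci {f : ℝ → ℝ} (hc : Continuous f) {c : ℝ}
    (hf : ConcaveOn ℝ (Ioi c) f) : ConcaveOn ℝ (Ici c) f := by
  have := aux_closure' hf hc
  rwa [closure_Ioi] at this

lemma aux_shape {g : ℝ → ℝ} (hg : Continuous g) (hmono : MonotoneOn g (Ici 0))
    (hc : ∃ c : EReal, 0 ≤ c ∧ ConvexOn ℝ {x : ℝ | 0 < x ∧ (x : EReal) < c} g ∧
      ConcaveOn ℝ {x : ℝ | c < (x : EReal)} g) {n : ℝ} (hn : 0 ≤ n) :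
    ∃ c' : ℝ, 0 ≤ c' ∧ ConvexOn ℝ (Icc 0 c') (fun x => g (min x n)) ∧
      ConcaveOn ℝ (Ici c') (fun x => g (min x n)) := by
  obtain ⟨c, hc0, hconv, hconc⟩ := hc
  have hgn : Continuous (fun x => g (min x n)) := by fun_prop
  -- first case : n ≤ c
  have case1 : (n : EReal) ≤ c → ∃ c' : ℝ, 0 ≤ c' ∧
      ConvexOn ℝ (Icc 0 c') (fun x => g (min x n)) ∧
      ConcaveOn ℝ (Ici c') (fun x => g (min x n)) := by
    intro hnc
    refine ⟨n, hn, ?_, ?_⟩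
    · refine aux_convIcc hgn hn ?_
      have h1 : ConvexOn ℝ (Ioo 0 n) g := hconv.subset (fun x hx =>
        ⟨hx.1, lt_of_lt_of_le (EReal.coe_lt_coe_iff.2 hx.2) hnc⟩) (convex_Ioo 0 n)
      refine h1.congr (fun x hx => ?_)
      simp [min_eq_left hx.2.le]
    · refine (concaveOn_const (g n) (convex_Ici n)).congr (fun x hx => ?_)
      simp [min_eq_right (mem_Ici.1 hx)]
  rcases le_or_gt (n : EReal) c with h | h
  · exact case1 h
  · induction c with
    | bot => simp at hc0
    | top => simp at h
    | coe c =>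
      have hcn : c < n := EReal.coe_lt_coe_iff.1 h
      have hc0' : 0 ≤ c := by exact_mod_cast hc0
      refine ⟨c, hc0', ?_, ?_⟩
      · refine aux_convIcc hgn hc0' ?_
        have h1 : ConvexOn ℝ (Ioo 0 c) g := hconv.subset (fun x hx =>
          ⟨hx.1, EReal.coe_lt_coe_iff.2 hx.2⟩) (convex_Ioo 0 c)
        refine h1.congr (fun x hx => ?_)
        simp [min_eq_left (hx.2.le.trans hcn.le)]
      · refine aux_concIci hgn ?_
        have h1 : ConcaveOn ℝ (Ioi c) g := hconc.subset (fun x hx =>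
          EReal.coe_lt_coe_iff.2 hx) (convex_Ioi c)
        refine (h1.inf (concaveOn_const (g n) (convex_Ioi c))).congr (fun x hx => ?_)
        have hx0 : 0 ≤ x := hc0'.trans (le_of_lt hx)
        simp only [Pi.inf_apply]
        rcases le_total x n with e | e
        · rw [min_eq_left e]; exact min_eq_left (hmono hx0 hn e)
        · rw [min_eq_right e]; exact min_eq_right (hmono hn hx0 e)

/-- the strictly convex, then strictly concave perturbation -/
noncomputable def phiP (c x : ℝ) : ℝ := (min x c) ^ 2 + (1 - Real.exp (-(max (x - c) 0)))

lemma phiP_cont (c : ℝ) : Continuous (phiP c) := by unfold phiP; fun_prop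

lemma phiP_nonneg (c x : ℝ) : 0 ≤ phiP c x := by
  unfold phiP
  have : Real.exp (-(max (x - c) 0)) ≤ 1 := Real.exp_le_one_iff.2 (by simp)
  nlinarith [sq_nonneg (min x c)]

lemma phiP_le {c x : ℝ} (hc : 0 ≤ c) (hx : 0 ≤ x) : phiP c x ≤ c ^ 2 + 1 := by
  unfold phiP
  have h1 := Real.exp_pos (-(max (x - c) 0))
  have h2 : (min x c) ^ 2 ≤ c ^ 2 := pow_le_pow_left₀ (le_min hx hc) (min_le_right _ _) 2
  linarith

lemma phiP_mono {c : ℝ} (hc : 0 ≤ c) : MonotoneOn (phiP c) (Ici 0) := by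
  intro x hx y hy hxy
  unfold phiP
  have h2 : (min x c) ^ 2 ≤ (min y c) ^ 2 :=
    pow_le_pow_left₀ (le_min hx hc) (min_le_min_right c hxy) 2
  have h3 : Real.exp (-(max (y - c) 0)) ≤ Real.exp (-(max (x - c) 0)) := by
    apply Real.exp_le_exp.2
    have : max (x - c) 0 ≤ max (y - c) 0 := max_le_max_right 0 (by linarith)
    linarith
  linarith

lemma phiP_conv {c : ℝ} : StrictConvexOn ℝ (Icc 0 c) (phiP c) := by
  have h : StrictConvexOn ℝ (Icc 0 c) (fun x : ℝ => x ^ 2) :=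
    (Even.strictConvexOn_pow (n := 2) even_two (by norm_num)).subset (subset_univ _)
      (convex_Icc 0 c)
  refine h.congr (fun x hx => ?_)
  simp [phiP, hx.2]

lemma phiP_conc {c : ℝ} : StrictConcaveOn ℝ (Ici c) (phiP c) := by
  have h : StrictConcaveOn ℝ (Ici c) (fun x : ℝ => c ^ 2 + (1 - Real.exp (-(x - c)))) := by
    refine ⟨convex_Ici c, fun x _ y _ hxy a b ha hb hab => ?_⟩
    have h1 := strictConvexOn_exp.2 (mem_univ (-(x - c))) (mem_univ (-(y - c)))
      (by intro e; apply hxy; linarith) ha hb hab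
    simp only [smul_eq_mul] at h1 ⊢
    have e : -(a * x + b * y - c) = a * -(x - c) + b * -(y - c) := by
      linear_combination (-c) * hab
    rw [e]
    have e2 : a * (c ^ 2 + (1 - Real.exp (-(x - c)))) + b * (c ^ 2 + (1 - Real.exp (-(y - c))))
      = c ^ 2 + 1 - (a * Real.exp (-(x - c)) + b * Real.exp (-(y - c))) := by
      linear_combination (c ^ 2 + 1) * hab
    rw [e2]
    linarith
  refine h.congr (fun x hx => ?_)
  have hx' : c ≤ x := hx
  simp only [phiP]
  rw [min_eq_right hx', max_eq_left (by linarith)]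

lemma aux_FTC {g : ℝ → ℝ} (hg : Continuous g) (x : ℝ) :
    HasDerivAt (fun x => ∫ u in (0:ℝ)..x, g u) (g x) x :=
  intervalIntegral.integral_hasDerivAt_right (hg.intervalIntegrable _ _)
    (hg.stronglyMeasurableAtFilter _ _) hg.continuousAt

lemma aux_int_nonneg {g : ℝ → ℝ} (hg0 : ∀ x, 0 ≤ x → 0 ≤ g x) {x : ℝ} (hx : 0 ≤ x) :
    0 ≤ ∫ u in (0:ℝ)..x, g u :=
  intervalIntegral.integral_nonneg hx (fun u hu => hg0 u hu.1)

lemma aux_int_mono {g k : ℝ → ℝ} (hg : Continuous g) (hk : Continuous k) {x : ℝ} (hx : 0 ≤ x)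
    (hgk : ∀ u, 0 ≤ u → u ≤ x → g u ≤ k u) :
    (∫ u in (0:ℝ)..x, g u) ≤ ∫ u in (0:ℝ)..x, k u :=
  intervalIntegral.integral_mono_on hx (hg.intervalIntegrable _ _) (hk.intervalIntegrable _ _)
    (fun u hu => hgk u hu.1 hu.2)

lemma aux_int_le {g : ℝ → ℝ} (hg : Continuous g) {K x : ℝ} (hx : 0 ≤ x)
    (hK : ∀ u, 0 ≤ u → u ≤ x → g u ≤ K) : (∫ u in (0:ℝ)..x, g u) ≤ K * x := by
  have := aux_int_mono hg (continuous_const (y := K)) hx hK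
  rw [intervalIntegral.integral_const] at this
  simpa [mul_comm] using this

lemma twoPt_mono {m v t : ℝ} {f k : ℝ → ℝ} (hv : 0 < v) (ht : 0 < t) (htm : t ≤ m)
    (hfk : ∀ x, 0 ≤ x → f x ≤ k x) : twoPt m v f t ≤ twoPt m v k t := by
  unfold twoPt
  have hvt : 0 < v / t := div_pos hv ht
  have h1 := hfk (m - t) (by linarith)
  have h2 := hfk (m + v / t) (by linarith)
  gcongr

lemma aux_quad {P : Measure ℝ} (hP : IsProbabilityMeasure P)
    (hi1 : Integrable (fun x => x) P) (hi2 : Integrable (fun x => x ^ 2) P) (A B C : ℝ) :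
    ∫ x, (A + B * x + C * x ^ 2) ∂P = A + B * (∫ x, x ∂P) + C * (∫ x, x ^ 2 ∂P) := by
  have i1 : Integrable (fun x => A + B * x) P := (integrable_const A).add (hi1.const_mul B)
  rw [integral_add i1 (hi2.const_mul C),
    integral_add (integrable_const A) (hi1.const_mul B), integral_const_mul, integral_const_mul]
  simp

lemma aux_approx {g : ℝ → ℝ} (hg : Continuous g) (hmono : MonotoneOn g (Ici 0)) (hg0 : g 0 = 0)
    {K : ℝ} (hgK : ∀ x, 0 ≤ x → g x ≤ K) {c : ℝ} (hc : 0 ≤ c)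
    (hconv : ConvexOn ℝ (Icc 0 c) g) (hconc : ConcaveOn ℝ (Ici c) g)
    {P : Measure ℝ} (hP : IsProbabilityMeasure P) (hP0 : P (Iio 0) = 0)
    (hi1 : Integrable (fun x => x) P) (hi2 : Integrable (fun x => x ^ 2) P)
    {m v : ℝ} (hmdef : ∫ x, x ∂P = m) (hvdef : ∫ x, x ^ 2 ∂P = v + m ^ 2)
    (hm : 0 < m) (hv : 0 < v) {ε : ℝ} (hε : 0 < ε) :
    ∃ t, 0 < t ∧ t ≤ m ∧
      ∫ x, (∫ u in (0:ℝ)..x, g u) ∂P ≤ twoPt m v (fun x => ∫ u in (0:ℝ)..x, g u) t + ε := by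
  set G : ℝ → ℝ := fun x => ∫ u in (0:ℝ)..x, g u with hGdef
  set F : ℝ → ℝ := fun x => ∫ u in (0:ℝ)..x, phiP c u with hFdef
  have hgnn : ∀ x, 0 ≤ x → 0 ≤ g x := fun x hx => by
    rw [← hg0]; exact hmono self_mem_Ici hx hx
  set δ := ε / ((c ^ 2 + 1) * m) with hδ
  have hδ0 : 0 < δ := by positivity
  have hGnn : ∀ x, 0 ≤ x → 0 ≤ G x := fun x hx => aux_int_nonneg hgnn hx
  have hFnn : ∀ x, 0 ≤ x → 0 ≤ F x := fun x hx =>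
    aux_int_nonneg (fun x _ => phiP_nonneg c x) hx
  have hFle : ∀ x, 0 ≤ x → F x ≤ (c ^ 2 + 1) * x := fun x hx =>
    aux_int_le (phiP_cont c) hx (fun u hu _ => phiP_le hc hu)
  have hGle : ∀ x, 0 ≤ x → G x ≤ K * x := fun x hx =>
    aux_int_le hg hx (fun u hu _ => hgK u hu)
  have hder : ∀ x, HasDerivAt (fun x => G x + δ * F x) (g x + δ * phiP c x) x := fun x =>
    (aux_FTC hg x).add ((aux_FTC (phiP_cont c) x).const_mul δ)
  have hGc : ConvexOn ℝ (Ici 0) (fun x => G x + δ * F x) := by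
    refine MonotoneOn.convexOn_of_deriv (convex_Ici 0)
      (fun x _ => (hder x).continuousAt.continuousWithinAt)
      (fun x _ => (hder x).differentiableAt.differentiableWithinAt) ?_
    intro x hx y hy hxy
    rw [(hder x).deriv, (hder y).deriv]
    have hx' := interior_subset hx
    have hy' := interior_subset hy
    have h1 := hmono hx' hy' hxy
    have h2 := phiP_mono hc hx' hy' hxy
    nlinarith
  have hs1 : StrictConvexOn ℝ (Icc 0 c) (fun x => g x + δ * phiP c x) := by
    refine ⟨convex_Icc 0 c, fun x hx y hy hxy a b ha hb hab => ?_⟩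
    have h1 := hconv.2 hx hy ha.le hb.le hab
    have h2 := phiP_conv.2 hx hy hxy ha hb hab
    simp only [smul_eq_mul] at h1 h2 ⊢
    nlinarith [mul_lt_mul_of_pos_left h2 hδ0]
  have hs2 : StrictConcaveOn ℝ (Ici c) (fun x => g x + δ * phiP c x) := by
    refine ⟨convex_Ici c, fun x hx y hy hxy a b ha hb hab => ?_⟩
    have h1 := hconc.2 hx hy ha.le hb.le hab
    have h2 := phiP_conc.2 hx hy hxy ha hb hab
    simp only [smul_eq_mul] at h1 h2 ⊢
    nlinarith [mul_lt_mul_of_pos_left h2 hδ0]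
  obtain ⟨t, ht, htm, A, B, C, hq, hqv⟩ := aux_opt hder hGc (K := K + δ * (c ^ 2 + 1))
    (fun x hx => add_nonneg (hGnn x hx) (mul_nonneg hδ0.le (hFnn x hx)))
    (fun x hx => by
      have h1 := hGle x hx
      have h2 := mul_le_mul_of_nonneg_left (hFle x hx) hδ0.le
      nlinarith) hc hs1 hs2 hm hv
  refine ⟨t, ht, htm, ?_⟩
  have hae : ∀ᵐ x ∂P, 0 ≤ x := by
    rw [ae_iff]
    simpa [Iio] using hP0
  have hqi : Integrable (fun x => A + B * x + C * x ^ 2) P :=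
    ((integrable_const A).add (hi1.const_mul B)).add (hi2.const_mul C)
  have hle : ∫ x, G x ∂P ≤ ∫ x, (A + B * x + C * x ^ 2) ∂P := by
    refine integral_mono_of_nonneg ?_ hqi ?_
    · filter_upwards [hae] with x hx using hGnn x hx
    · filter_upwards [hae] with x hx
      have := hq x hx
      have := mul_nonneg hδ0.le (hFnn x hx)
      linarith
  have hval : ∫ x, (A + B * x + C * x ^ 2) ∂P = A + B * m + C * (v + m ^ 2) := by
    rw [aux_quad hP hi1 hi2, hmdef, hvdef]
  have hlast : twoPt m v (fun x => G x + δ * F x) t ≤ twoPt m v G t + ε := by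
    refine (twoPt_mono (k := fun x => G x + δ * ((c ^ 2 + 1) * x)) hv ht htm (fun x hx => ?_)).trans
      (le_of_eq ?_)
    · have := mul_le_mul_of_nonneg_left (hFle x hx) hδ0.le
      linarith
    · have e : ε = δ * ((c ^ 2 + 1) * m) := by rw [hδ]; field_simp
      rw [e]
      unfold twoPt
      field_simp
      ring
  linarith

/-- the two point measure -/
noncomputable def twoQ (m v t : ℝ) : Measure ℝ :=
  ENNReal.ofReal (v / (v + t ^ 2)) • Measure.dirac (m - t) +
    ENNReal.ofReal (t ^ 2 / (v + t ^ 2)) • Measure.dirac (m + v / t)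

lemma twoQ_integrable (m v t : ℝ) (f : ℝ → ℝ) : Integrable f (twoQ m v t) := by
  unfold twoQ
  exact ((integrable_dirac (by simp)).smul_measure ENNReal.ofReal_ne_top).add_measure
    ((integrable_dirac (by simp)).smul_measure ENNReal.ofReal_ne_top)

lemma twoQ_integral {m v t : ℝ} (hv : 0 < v) (f : ℝ → ℝ) :
    ∫ x, f x ∂(twoQ m v t) = twoPt m v f t := by
  unfold twoQ
  rw [integral_add_measure ((integrable_dirac (by simp)).smul_measure ENNReal.ofReal_ne_top)
    ((integrable_dirac (by simp)).smul_measure ENNReal.ofReal_ne_top), integral_smul_measure,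
    integral_smul_measure, integral_dirac, integral_dirac,
    ENNReal.toReal_ofReal (by positivity), ENNReal.toReal_ofReal (by positivity)]
  simp only [smul_eq_mul, twoPt]
  ring

lemma twoQ_null {m v t : ℝ} {s : Set ℝ} (h1 : m - t ∉ s) (h2 : m + v / t ∉ s) :
    twoQ m v t s = 0 := by
  unfold twoQ
  simp [h1, h2]

lemma twoQ_prob {m v t : ℝ} (hv : 0 < v) : IsProbabilityMeasure (twoQ m v t) := by
  constructor
  unfold twoQ
  simp only [Measure.coe_add, Measure.coe_smul, Pi.add_apply, Pi.smul_apply, measure_univ,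
    smul_eq_mul, mul_one]
  rw [← ENNReal.ofReal_add (by positivity) (by positivity), ← add_div,
    div_self (by positivity), ENNReal.ofReal_one]

lemma aux_main {h : ℝ → ℝ} {a : ℝ} (hmeas : Measurable h) {M : ℝ} (hM : ∀ x, |h x| ≤ M)
    (hHconv : ConvexOn ℝ (Set.Ici (0:ℝ)) (Hfun a h))
    (hH' : ∃ c : EReal, 0 ≤ c ∧
      ConvexOn ℝ {x : ℝ | 0 < x ∧ (x : EReal) < c} (deriv (Hfun a h)) ∧
      ConcaveOn ℝ {x : ℝ | c < (x : EReal)} (deriv (Hfun a h))) :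
    (∀ x, 0 ≤ x → 0 ≤ Hfun a h x ∧ Hfun a h x ≤ M * x ^ 2) ∧ Continuous (Hfun a h) ∧
    ∀ {P : Measure ℝ}, IsProbabilityMeasure P → P (Iio 0) = 0 →
    Integrable (fun x => x) P → Integrable (fun x => x ^ 2) P →
    ∀ {m v : ℝ}, ∫ x, x ∂P = m → ∫ x, x ^ 2 ∂P = v + m ^ 2 →
    0 < m → 0 < v → ∀ {ε : ℝ}, 0 < ε →
    ∃ t, 0 < t ∧ t ≤ m ∧ ∫ x, Hfun a h x ∂P ≤ twoPt m v (Hfun a h) t + ε := by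
  set g : ℝ → ℝ := fun u => ∫ v in (0:ℝ)..u, h (v + a) with hgdef
  have hM0 : 0 ≤ M := (abs_nonneg _).trans (hM 0)
  have hint : ∀ x y, IntervalIntegrable (fun v => h (v + a)) volume x y := by
    intro x y
    refine (intervalIntegrable_const (c := M)).mono_fun
      (hmeas.comp (measurable_id.add_const a)).aestronglyMeasurable ?_
    refine Eventually.of_forall fun z => ?_
    simp only [Real.norm_eq_abs]
    exact (hM _).trans (le_abs_self M)
  have hg : Continuous g := intervalIntegral.continuous_primitive hint 0
  have hH : ∀ x, Hfun a h x = ∫ u in (0:ℝ)..x, g u := fun x => rfl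
  have hder : ∀ x, HasDerivAt (Hfun a h) (g x) x := fun x => aux_FTC hg x
  have hderiv : deriv (Hfun a h) = g := funext fun x => (hder x).deriv
  rw [hderiv] at hH'
  have hHcont : Continuous (Hfun a h) :=
    continuous_iff_continuousAt.2 fun x => (hder x).continuousAt
  have hg0 : g 0 = 0 := by simp [hgdef]
  have hmono : MonotoneOn g (Ici 0) := by
    have h1 := hHconv.monotoneOn_deriv (fun x _ => (hder x).differentiableAt)
    rwa [hderiv] at h1
  have hgnn : ∀ x, 0 ≤ x → 0 ≤ g x := fun x hx => by
    rw [← hg0]; exact hmono self_mem_Ici hx hx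
  have hgM : ∀ x, 0 ≤ x → g x ≤ M * x := by
    intro x hx
    have := intervalIntegral.norm_integral_le_of_norm_le_const (a := 0) (b := x)
      (f := fun v => h (v + a)) (C := M) (fun z _ => hM _)
    rw [sub_zero, abs_of_nonneg hx] at this
    exact (le_abs_self _).trans this
  have hHb : ∀ x, 0 ≤ x → 0 ≤ Hfun a h x ∧ Hfun a h x ≤ M * x ^ 2 := by
    intro x hx
    refine ⟨aux_int_nonneg hgnn hx, ?_⟩
    have := aux_int_le hg hx (K := M * x)
      (fun u hu hux => (hgM u hu).trans (mul_le_mul_of_nonneg_left hux hM0))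
    rw [hH]
    nlinarith
  refine ⟨hHb, hHcont, ?_⟩
  intro P hP hP0 hi1 hi2 m v hmdef hvdef hm hv ε hε
  have hae : ∀ᵐ x ∂P, 0 ≤ x := by
    rw [ae_iff]
    simpa [Iio] using hP0
  set G : ℕ → ℝ → ℝ := fun n x => ∫ u in (0:ℝ)..x, g (min u n) with hG
  have hgn : ∀ n : ℕ, Continuous (fun u => g (min u n)) := fun n => by fun_prop
  have hGH : ∀ n x, 0 ≤ x → G n x ≤ Hfun a h x := by
    intro n x hx
    refine aux_int_mono (hgn n) hg hx (fun u hu _ => ?_)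
    exact hmono (mem_Ici.2 (le_min hu (Nat.cast_nonneg n))) hu (min_le_left _ _)
  have hGnn : ∀ n x, 0 ≤ x → 0 ≤ G n x := fun n x hx =>
    aux_int_nonneg (fun u hu => hgnn _ (le_min hu (Nat.cast_nonneg n))) hx
  have hlim : Tendsto (fun n => ∫ x, G n x ∂P) atTop (𝓝 (∫ x, Hfun a h x ∂P)) := by
    refine tendsto_integral_of_dominated_convergence (fun x => M * x ^ 2) ?_
      (hi2.const_mul M) ?_ ?_
    · intro n
      have : Continuous (G n) :=
        continuous_iff_continuousAt.2 fun x => (aux_FTC (hgn n) x).continuousAt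
      exact this.aestronglyMeasurable
    · intro n
      filter_upwards [hae] with x hx
      rw [Real.norm_eq_abs, abs_of_nonneg (hGnn n x hx)]
      exact (hGH n x hx).trans (hHb x hx).2
    · filter_upwards [hae] with x hx
      refine tendsto_const_nhds.congr' ?_
      obtain ⟨N, hN⟩ := exists_nat_ge x
      filter_upwards [eventually_ge_atTop N] with n hn
      rw [hH]
      refine intervalIntegral.integral_congr (fun u hu => ?_)
      rw [uIcc_of_le hx] at hu
      have : (N : ℝ) ≤ n := by exact_mod_cast hn
      rw [min_eq_left (by linarith [hu.2])]
  have hev := hlim.eventually (lt_mem_nhds (show ∫ x, Hfun a h x ∂P - ε / 2 <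
    ∫ x, Hfun a h x ∂P by linarith))
  obtain ⟨n, hn⟩ := hev.exists
  have hn0 : (0:ℝ) ≤ n := Nat.cast_nonneg n
  obtain ⟨c', hc', hs1, hs2⟩ := aux_shape hg hmono hH' hn0
  have hmonon : MonotoneOn (fun u => g (min u n)) (Ici 0) := fun x hx y hy hxy =>
    hmono (mem_Ici.2 (le_min hx hn0)) (mem_Ici.2 (le_min hy hn0)) (min_le_min_right _ hxy)
  obtain ⟨t, ht, htm, hle⟩ := aux_approx (hgn n) hmonon (by simp [hn0, hg0]) (K := g n)
    (fun x hx => hmono (mem_Ici.2 (le_min hx hn0)) hn0 (min_le_right _ _)) hc' hs1 hs2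
    hP hP0 hi1 hi2 hmdef hvdef hm hv (half_pos hε)
  refine ⟨t, ht, htm, ?_⟩
  have h3 := twoPt_mono hv ht htm (hGH n)
  have h4 : ∫ x, G n x ∂P ≤ twoPt m v (G n) t + ε / 2 := hle
  linarith

/-- Proposition: under convexity of `H` and a convex–concave property of `H′` (with
break point `c`, possibly `∞`), `ÕPT(𝒫⁺)` has the same optimal value as `ÕPT(𝒫₂⁺)`. -/
theorem ROPT_eq_ROPT2
    (a βl βu ηl ηu ν : ℝ)
    (hβl : 0 < βl) (hβ : βl ≤ βu) (hηl : 0 < ηl) (hη : ηl ≤ ηu) (hν : 0 < ν)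
    (h : ℝ → ℝ) (hmeas : Measurable h) (hbd : ∃ M, ∀ x, |h x| ≤ M)
    (μl μu σl σu : ℝ)
    (hμl : μl = ηl / ν) (hμu : μu = ηu / ν) (hσl : σl = 2 * βl / ν) (hσu : σu = 2 * βu / ν)
    (hHconv : ConvexOn ℝ (Set.Ici (0:ℝ)) (Hfun a h))
    (hH' : ∃ c : EReal, 0 ≤ c ∧
      ConvexOn ℝ {x : ℝ | 0 < x ∧ (x : EReal) < c} (deriv (Hfun a h)) ∧
      ConcaveOn ℝ {x : ℝ | c < (x : EReal)} (deriv (Hfun a h))) :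
    sSup {z : ℝ | ∃ P : Measure ℝ, RMomFeasible μl μu σl σu P ∧
      z = ν * ∫ x, Hfun a h x ∂P} =
    sSup {z : ℝ | ∃ P : Measure ℝ, RMomFeasible μl μu σl σu P ∧ SuppAtMost 2 P ∧
      z = ν * ∫ x, Hfun a h x ∂P} := by
  obtain ⟨M, hM⟩ := hbd
  obtain ⟨hHb, hHcont, hmain⟩ := aux_main hmeas hM hHconv hH'
  have hM0 : 0 ≤ M := (abs_nonneg _).trans (hM 0)
  have hμpos : 0 < μl := by rw [hμl]; positivity
  have hbdd : BddAbove {z : ℝ | ∃ P : Measure ℝ, RMomFeasible μl μu σl σu P ∧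
      z = ν * ∫ x, Hfun a h x ∂P} := by
    refine ⟨ν * (M * σu), ?_⟩
    rintro z ⟨P, ⟨hP, hP0, hi1, hi2, h1, h2, h3, h4⟩, rfl⟩
    refine mul_le_mul_of_nonneg_left ?_ hν.le
    have hae : ∀ᵐ x ∂P, 0 ≤ x := by
      rw [ae_iff]
      simpa [Iio] using hP0
    have : ∫ x, Hfun a h x ∂P ≤ ∫ x, M * x ^ 2 ∂P := by
      refine integral_mono_of_nonneg ?_ (hi2.const_mul M) ?_
      · filter_upwards [hae] with x hx using (hHb x hx).1
      · filter_upwards [hae] with x hx using (hHb x hx).2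
    rw [integral_const_mul] at this
    exact this.trans (mul_le_mul_of_nonneg_left h4 hM0)
  have hsub : {z : ℝ | ∃ P : Measure ℝ, RMomFeasible μl μu σl σu P ∧ SuppAtMost 2 P ∧
      z = ν * ∫ x, Hfun a h x ∂P} ⊆ {z : ℝ | ∃ P : Measure ℝ, RMomFeasible μl μu σl σu P ∧
      z = ν * ∫ x, Hfun a h x ∂P} := by
    rintro z ⟨P, hP, _, rfl⟩
    exact ⟨P, hP, rfl⟩
  -- approximation by two-point measures
  have key : ∀ P : Measure ℝ, RMomFeasible μl μu σl σu P → ∀ ε : ℝ, 0 < ε →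
      ∃ Q : Measure ℝ, RMomFeasible μl μu σl σu Q ∧ SuppAtMost 2 Q ∧
        ∫ x, Hfun a h x ∂P ≤ ∫ x, Hfun a h x ∂Q + ε := by
    intro P hPf ε hε
    obtain ⟨hP, hP0, hi1, hi2, h1, h2, h3, h4⟩ := id hPf
    set m := ∫ x, x ∂P with hm
    obtain ⟨v, hv⟩ : ∃ v, v = ∫ x, x ^ 2 ∂P - m ^ 2 := ⟨_, rfl⟩
    have hvar : ∫ x, (x - m) ^ 2 ∂P = v := by
      have e : (fun x : ℝ => (x - m) ^ 2) = fun x => m ^ 2 + (-2 * m) * x + 1 * x ^ 2 := by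
        funext x; ring
      rw [e, aux_quad hP hi1 hi2, ← hm, hv]
      ring
    have hvi : Integrable (fun x => (x - m) ^ 2) P := by
      have e : (fun x : ℝ => (x - m) ^ 2) = fun x => m ^ 2 + (-2 * m) * x + 1 * x ^ 2 := by
        funext x; ring
      rw [e]
      exact ((integrable_const _).add (hi1.const_mul _)).add (hi2.const_mul _)
    have hv0 : 0 ≤ v := by rw [← hvar]; exact integral_nonneg fun x => sq_nonneg _
    rcases hv0.eq_or_lt with e | e
    · refine ⟨P, hPf, ⟨{m}, by simp, ?_⟩, by linarith⟩
      rw [← e, integral_eq_zero_iff_of_nonneg (fun x => sq_nonneg _) hvi] at hvar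
      have : ∀ᵐ x ∂P, x ∈ ({m} : Set ℝ) := by
        filter_upwards [hvar] with x hx
        have : x - m = 0 := pow_eq_zero_iff (two_ne_zero) |>.1 hx
        simp only [mem_singleton_iff]; linarith
      rw [ae_iff] at this
      simpa [compl_def] using this
    · have hmpos : 0 < m := by linarith
      obtain ⟨t, ht, htm, hle⟩ := hmain hP hP0 hi1 hi2 (m := m) (v := v) hm.symm
        (by linarith) hmpos e hε
      have hvt : 0 < v / t := div_pos e ht
      have E1 : ∫ x, x ∂(twoQ m v t) = m := by
        rw [twoQ_integral e (fun x => x)]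
        unfold twoPt
        field_simp
        ring
      have E2 : ∫ x, x ^ 2 ∂(twoQ m v t) = ∫ x, x ^ 2 ∂P := by
        rw [twoQ_integral e (fun x => x ^ 2)]
        have : ∫ x, x ^ 2 ∂P = v + m ^ 2 := by linarith
        rw [this]
        unfold twoPt
        field_simp
        ring
      refine ⟨twoQ m v t, ⟨twoQ_prob e, ?_, twoQ_integrable _ _ _ _, twoQ_integrable _ _ _ _,
        ?_, ?_, ?_, ?_⟩, ⟨{m - t, m + v / t}, Finset.card_le_two, ?_⟩, ?_⟩
      · refine twoQ_null ?_ ?_ <;> simp only [mem_Iio] <;> linarith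
      · rw [E1]; exact h1
      · rw [E1]; exact h2
      · rw [E2]; exact h3
      · rw [E2]; exact h4
      · refine twoQ_null ?_ ?_ <;> simp
      · rw [twoQ_integral e]; exact hle
  rcases Set.eq_empty_or_nonempty {z : ℝ | ∃ P : Measure ℝ, RMomFeasible μl μu σl σu P ∧
      z = ν * ∫ x, Hfun a h x ∂P} with hemp | hne
  · have h2 := hsub
    rw [hemp] at h2
    rw [hemp, Set.subset_empty_iff.1 h2]
  · apply le_antisymm
    · refine csSup_le hne ?_
      rintro z ⟨P, hP, rfl⟩
      refine le_of_forall_pos_le_add fun ε hε => ?_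
      obtain ⟨Q, hQ, hQ2, hle⟩ := key P hP (ε / ν) (div_pos hε hν)
      have h1 : ν * ∫ x, Hfun a h x ∂Q ≤ sSup {z : ℝ | ∃ P : Measure ℝ,
          RMomFeasible μl μu σl σu P ∧ SuppAtMost 2 P ∧ z = ν * ∫ x, Hfun a h x ∂P} :=
        le_csSup (hbdd.mono hsub) ⟨Q, hQ, hQ2, rfl⟩
      have h2 := mul_le_mul_of_nonneg_left hle hν.le
      rw [mul_add, mul_div_cancel₀ _ hν.ne'] at h2
      linarith
    · obtain ⟨z, P, hP, rfl⟩ := hne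
      obtain ⟨Q, hQ, hQ2, -⟩ := key P hP 1 one_pos
      exact csSup_le_csSup hbdd ⟨_, Q, hQ, hQ2, rfl⟩ hsub
end

section
/- Let a ∈ ℝ and 0 < β̲ ≤ β̄, 0 < η̲ ≤ η̄, ν̄ > 0 with η̲² < 2β̄ν̄. Let h : ℝ → ℝ be bounded, nonnegative, non-decreasing on [a, c) and non-increasing on (c, ∞) for some c with a ≤ c ≤ ∞, and suppose the limit λ = lim_{x→∞} H(x)/x² exists and is finite. Then the optimal value of the relaxed worst-case tail problem equals max{ max over ρ ∈ [max(σ̲, μ̄²), σ̄] and x₁ ∈ [0, μ̄] of 𝒲(x₁, μ̄, ρ), max over ω ∈ [μ̲, min(μ̄, √σ̄)] and x₁ ∈ [0, ω] of 𝒲(x₁, ω, σ̄) }. -/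
open MeasureTheory Set Filter Topology

/-- The right derivative of `f` at `x`: the derivative within `(x, ∞)`. -/
noncomputable def rightDeriv (f : ℝ → ℝ) (x : ℝ) : ℝ := derivWithin f (Set.Ioi x) x

/-- The right derivative of `f` exists at `x`. -/
def HasRightDerivAt (f : ℝ → ℝ) (x : ℝ) : Prop := ∃ d : ℝ, HasDerivWithinAt f d (Set.Ioi x) x

/-- `f` is feasible for the relaxed worst-case tail problem with parameters
`(a, β̲, β̄, η̲, η̄, ν̄)`. -/
def RFeasible (a βl βu ηl ηu ν : ℝ) (f : ℝ → ℝ) : Prop :=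
  IntegrableOn f (Set.Ioi a) ∧
  βl ≤ (∫ x in Set.Ioi a, f x) ∧ (∫ x in Set.Ioi a, f x) ≤ βu ∧
  ηl ≤ f a ∧ f a ≤ ηu ∧
  ContinuousWithinAt f (Set.Ici a) a ∧
  HasRightDerivAt f a ∧
  -ν ≤ rightDeriv f a ∧
  ConvexOn ℝ (Set.Ici a) f ∧
  (∀ x, a ≤ x → 0 ≤ f x)

/-- The two-dimensional line-search objective `𝒲(x, ω, ρ)`
(with `𝒲(ω, ω, ρ) = ν̄(H(ω) + λ(ρ − ω²))`). -/
noncomputable def Wcal (a ν lam : ℝ) (h : ℝ → ℝ) (x ω ρ : ℝ) : ℝ :=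
  if x = ω then ν * (Hfun a h ω + lam * (ρ - ω ^ 2))
  else ν * ((ρ - ω ^ 2) / (ρ - 2 * ω * x + x ^ 2) * Hfun a h x +
    (ω - x) ^ 2 / (ρ - 2 * ω * x + x ^ 2) * Hfun a h ((ρ - ω * x) / (ω - x)))

/-! ### Basic integrals -/

/-- The ramp function `(y - x)⁺`. -/
noncomputable def ramp (y x : ℝ) : ℝ := max (y - x) 0

lemma ramp_nonneg (y x : ℝ) : 0 ≤ ramp y x := le_max_right _ _

lemma ramp_of_le {y x : ℝ} (h : x ≤ y) : ramp y x = y - x := max_eq_left (by linarith)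

lemma ramp_of_ge {y x : ℝ} (h : y ≤ x) : ramp y x = 0 := max_eq_right (by linarith)

lemma le_ramp (y x : ℝ) : y - x ≤ ramp y x := le_max_left _ _

lemma ramp_continuous (y : ℝ) : Continuous (ramp y) := by
  unfold ramp; fun_prop

lemma ramp_convexOn (y : ℝ) (s : Set ℝ) (hs : Convex ℝ s) : ConvexOn ℝ s (ramp y) := by
  refine ⟨hs, ?_⟩
  intro u _ v _ p q hp hq hpq
  simp only [smul_eq_mul]
  unfold ramp
  apply max_le
  · have h1 := le_max_left (y - u) 0
    have h2 := le_max_left (y - v) 0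
    have : q = 1 - p := by linarith
    subst this
    nlinarith
  · have h1 := le_max_right (y - u) 0
    have h2 := le_max_right (y - v) 0
    positivity

lemma setIntegral_mul_ramp (k : ℝ → ℝ) {y c : ℝ} (hy : 0 ≤ y) (hc : y ≤ c) :
    ∫ x in Ioc 0 c, k x * ramp y x = ∫ x in (0:ℝ)..y, k x * (y - x) := by
  rw [intervalIntegral.integral_of_le hy]
  rw [setIntegral_eq_of_subset_of_forall_sdiff_eq_zero measurableSet_Ioc
    (Ioc_subset_Ioc_right hc)]
  · apply setIntegral_congr_fun measurableSet_Ioc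
    intro x hx
    simp only [ramp_of_le hx.2]
  · intro x hx
    have : y ≤ x := by
      by_contra hh
      exact hx.2 ⟨hx.1.1, by linarith⟩
    simp [ramp_of_ge this]

lemma setIntegral_Ioi_mul_ramp (k : ℝ → ℝ) {y : ℝ} (hy : 0 ≤ y) :
    ∫ x in Ioi 0, k x * ramp y x = ∫ x in (0:ℝ)..y, k x * (y - x) := by
  rw [intervalIntegral.integral_of_le hy]
  rw [setIntegral_eq_of_subset_of_forall_sdiff_eq_zero measurableSet_Ioi
    (fun x hx => hx.1 : Ioc (0:ℝ) y ⊆ Ioi 0)]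
  · apply setIntegral_congr_fun measurableSet_Ioc
    intro x hx
    simp only [ramp_of_le hx.2]
  · intro x hx
    have : y ≤ x := by
      by_contra hh
      exact hx.2 ⟨hx.1, by linarith⟩
    simp [ramp_of_ge this]

lemma integral_lin (y c : ℝ) : ∫ x in (0:ℝ)..c, (y - x) = y * c - c ^ 2 / 2 := by
  rw [intervalIntegral.integral_sub (by simp) (by simp)]
  simp; ring

lemma integral_ramp {y : ℝ} (hy : 0 ≤ y) : ∫ x in Ioi 0, ramp y x = y ^ 2 / 2 := by
  have := setIntegral_Ioi_mul_ramp (fun _ => 1) hy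
  simp only [one_mul] at this
  rw [this, integral_lin]; ring

lemma integral_ramp_Ioc {y c : ℝ} (hy : 0 ≤ y) (hc : y ≤ c) :
    ∫ x in Ioc 0 c, ramp y x = y ^ 2 / 2 := by
  have := setIntegral_mul_ramp (fun _ => 1) hy hc
  simp only [one_mul] at this
  rw [this, integral_lin]; ring

lemma integral_ramp_Ioc' {y c : ℝ} (hc0 : 0 ≤ c) (hc : c ≤ y) :
    ∫ x in Ioc 0 c, ramp y x = y ^ 2 / 2 - (y - c) ^ 2 / 2 := by
  have : ∫ x in Ioc 0 c, ramp y x = ∫ x in Ioc 0 c, (y - x) := by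
    apply setIntegral_congr_fun measurableSet_Ioc
    intro x hx
    exact ramp_of_le (hx.2.trans hc)
  rw [this, ← intervalIntegral.integral_of_le hc0, integral_lin]; ring

lemma ramp_integrableOn (y : ℝ) : IntegrableOn (ramp y) (Ioi 0) := by
  have h1 : IntegrableOn (ramp y) (Ioc 0 (max y 0)) :=
    ((ramp_continuous y).integrableOn_Icc).mono_set Ioc_subset_Icc_self
  have h2 : IntegrableOn (ramp y) (Ioi (max y 0)) := by
    refine (integrableOn_zero (ε' := ℝ)).congr_fun ?_ measurableSet_Ioi
    intro x hx
    exact (ramp_of_ge ((le_max_left _ _).trans (le_of_lt hx))).symm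
  have := h1.union h2
  rwa [Ioc_union_Ioi_eq_Ioi (le_max_right _ _)] at this

/-- Double integral of `k`. -/
lemma double_integral (k : ℝ → ℝ) {y : ℝ} (hy : 0 ≤ y) (hk : IntegrableOn k (Ioc 0 y)) :
    ∫ u in (0:ℝ)..y, (∫ v in (0:ℝ)..u, k v) = ∫ x in (0:ℝ)..y, k x * (y - x) := by
  rw [intervalIntegral.integral_of_le hy, intervalIntegral.integral_of_le hy]
  set μ := volume.restrict (Ioc (0:ℝ) y) with hμ
  have e1 : ∫ u in Ioc 0 y, (∫ v in (0:ℝ)..u, k v)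
      = ∫ u, ∫ v, (indicator {p : ℝ × ℝ | p.2 ≤ p.1} (fun p => k p.2)) (u, v) ∂μ ∂μ := by
    apply setIntegral_congr_fun measurableSet_Ioc
    intro u hu
    simp only
    rw [intervalIntegral.integral_of_le hu.1.le]
    have : (fun v => (indicator {p : ℝ × ℝ | p.2 ≤ p.1} (fun p => k p.2)) (u, v))
      = indicator (Iic u) k := by
      ext v; simp [indicator]
    rw [this, integral_indicator measurableSet_Iic, hμ, Measure.restrict_restrict measurableSet_Iic]
    congr 2
    ext v
    simp only [mem_inter_iff, mem_Iic, mem_Ioc]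
    constructor
    · intro h; exact ⟨h.2, h.1, h.2.trans hu.2⟩
    · intro h; exact ⟨h.2.1, h.1⟩
  rw [e1]
  have hIntg : Integrable (Function.uncurry fun u v =>
      (indicator {p : ℝ × ℝ | p.2 ≤ p.1} (fun p => k p.2)) (u, v)) (μ.prod μ) := by
    have : Integrable (fun p : ℝ × ℝ => k p.2) (μ.prod μ) := by
      exact Integrable.comp_snd (μ := μ) (ν := μ) hk
    exact this.indicator (measurableSet_le measurable_snd measurable_fst)
  rw [integral_integral_swap hIntg]
  apply setIntegral_congr_fun measurableSet_Ioc
  intro v hv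
  simp only
  have : (fun u => (indicator {p : ℝ × ℝ | p.2 ≤ p.1} (fun p => k p.2)) (u, v))
      = indicator (Ici v) (fun _ => k v) := by
      ext u; simp [indicator]
  rw [this, integral_indicator measurableSet_Ici, hμ, Measure.restrict_restrict measurableSet_Ici]
  have : Ici v ∩ Ioc 0 y = Icc v y := by
    ext u
    simp only [mem_inter_iff, mem_Ici, mem_Ioc, mem_Icc]
    constructor
    · intro h; exact ⟨h.1, h.2.2⟩
    · intro h; exact ⟨h.1, hv.1.trans_le h.1, h.2⟩
  rw [this]
  simp [hv.2, mul_comm]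

lemma integral_mul_ramp (a : ℝ) (h : ℝ → ℝ) {y : ℝ} (hy : 0 ≤ y)
    (hk : IntegrableOn (fun v => h (v + a)) (Ioc 0 y)) :
    ∫ x in Ioi 0, h (x + a) * ramp y x = Hfun a h y := by
  rw [setIntegral_Ioi_mul_ramp (fun x => h (x + a)) hy]
  unfold Hfun
  rw [double_integral (fun v => h (v + a)) hy hk]

/-- Correlation lemma: no duality needed. -/
lemma corr_nonneg {S : Set ℝ} (hS : MeasurableSet S) {k D : ℝ → ℝ} {M : ℝ}
    (hk0 : ∀ x, 0 ≤ k x) (hkM : ∀ x, k x ≤ M)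
    (hD : IntegrableOn D S) (hkD : IntegrableOn (fun x => k x * D x) S)
    (hIntg : ∫ x in S, D x = 0)
    (hord : ∀ x ∈ S, ∀ y ∈ S, D y < 0 → 0 < D x → k y ≤ k x) :
    0 ≤ ∫ x in S, k x * D x := by
  set T : Set ℝ := insert 0 (k '' {y | y ∈ S ∧ D y < 0}) with hT
  have hTb : BddAbove T := by
    refine ⟨M, ?_⟩
    rintro z (rfl | ⟨y, _, rfl⟩)
    · exact (hk0 0).trans (hkM 0)
    · exact hkM y
  have hTn : T.Nonempty := ⟨0, mem_insert _ _⟩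
  set κ := sSup T
  have key : ∀ x ∈ S, κ * D x ≤ k x * D x := by
    intro x hx
    rcases lt_trichotomy (D x) 0 with h1 | h1 | h1
    · have : k x ≤ κ := le_csSup hTb (mem_insert_of_mem _ ⟨x, ⟨hx, h1⟩, rfl⟩)
      nlinarith
    · simp [h1]
    · have : κ ≤ k x := by
        apply csSup_le hTn
        rintro z (rfl | ⟨y, hy, rfl⟩)
        · exact hk0 x
        · exact hord x hx y hy.1 hy.2 h1
      nlinarith
  have := setIntegral_mono_on (hD.const_mul κ) hkD hS key
  rw [integral_const_mul, hIntg, mul_zero] at this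
  exact this

/-! ### Admissible functions in shifted coordinates -/

/-- Shifted description of an admissible tail with first moment `ω` and second moment `ρ`. -/
structure Adm (ν ω ρ : ℝ) (g : ℝ → ℝ) : Prop where
  cont : ContinuousOn g (Ici 0)
  conv : ConvexOn ℝ (Ici 0) g
  nonneg : ∀ x, 0 ≤ x → 0 ≤ g x
  zero : g 0 = ν * ω
  lower : ∀ x, 0 ≤ x → ν * (ω - x) ≤ g x
  intg : IntegrableOn g (Ioi 0)
  integral : ∫ x in Ioi 0, g x = ν * ρ / 2
  anti : AntitoneOn g (Ici 0)

lemma Adm.lower' {ν ω ρ : ℝ} {g : ℝ → ℝ} (_hν : 0 < ν) (hg : Adm ν ω ρ g) {x : ℝ} (hx : 0 ≤ x) :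
    ν * ramp ω x ≤ g x := by
  rcases le_total x ω with h | h
  · rw [ramp_of_le h]; exact hg.lower x hx
  · rw [ramp_of_ge h, mul_zero]; exact hg.nonneg x hx

lemma Adm.sq_le {ν ω ρ : ℝ} {g : ℝ → ℝ} (hν : 0 < ν) (hω : 0 ≤ ω) (hg : Adm ν ω ρ g) :
    ω ^ 2 ≤ ρ := by
  have h1 : ∫ x in Ioi 0, ν * ramp ω x ≤ ∫ x in Ioi 0, g x :=
    setIntegral_mono_on ((ramp_integrableOn ω).const_mul ν) hg.intg measurableSet_Ioi
      (fun x hx => hg.lower' hν (le_of_lt hx))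
  rw [integral_const_mul, integral_ramp hω, hg.integral] at h1
  nlinarith

lemma bdd_mul_int {k g : ℝ → ℝ} {M : ℝ} {S : Set ℝ} (hk0 : ∀ x, 0 ≤ k x) (hkM : ∀ x, k x ≤ M)
    (hkm : AEStronglyMeasurable k (volume.restrict S)) (hg : IntegrableOn g S) :
    IntegrableOn (fun x => k x * g x) S := by
  refine Integrable.bdd_mul (c := M) hg hkm ?_
  filter_upwards with x
  rw [Real.norm_eq_abs, abs_of_nonneg (hk0 x)]
  exact hkM x

lemma Adm.upper_const {ν ω ρ M C : ℝ} {g k : ℝ → ℝ} (hν : 0 < ν) (hω : 0 ≤ ω) (hg : Adm ν ω ρ g)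
    (hk0 : ∀ x, 0 ≤ k x) (hkM : ∀ x, k x ≤ M)
    (hkm : AEStronglyMeasurable k (volume.restrict (Ioi 0)))
    (hC : ∀ x, 0 < x → k x ≤ C) :
    ∫ x in Ioi 0, k x * g x ≤
      ν * ((∫ x in Ioi 0, k x * ramp ω x) + C / 2 * (ρ - ω ^ 2)) := by
  have i1 := (ramp_integrableOn ω).const_mul ν
  have i2 : IntegrableOn (fun x => g x - ν * ramp ω x) (Ioi 0) := hg.intg.sub i1
  have h1 : ∫ x in Ioi 0, k x * g x ≤
      ∫ x in Ioi 0, (ν * (k x * ramp ω x) + C * (g x - ν * ramp ω x)) := by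
    apply setIntegral_mono_on (bdd_mul_int hk0 hkM hkm hg.intg)
      (((bdd_mul_int hk0 hkM hkm (ramp_integrableOn ω)).const_mul ν).add (i2.const_mul C))
      measurableSet_Ioi
    intro x hx
    have a1 := hg.lower' hν (le_of_lt hx)
    have a2 := hC x hx
    simp only [Pi.add_apply]
    nlinarith
  rw [integral_add ((bdd_mul_int hk0 hkM hkm (ramp_integrableOn ω)).const_mul ν)
    (i2.const_mul C), integral_const_mul, integral_const_mul, integral_sub hg.intg i1,
    integral_const_mul, integral_ramp hω, hg.integral] at h1
  linarith

/-- Two-point tail. -/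
noncomputable def fs (ν p₁ x₁ p₂ x₂ x : ℝ) : ℝ := ν * (p₁ * ramp x₁ x + p₂ * ramp x₂ x)

lemma fs_cont (ν p₁ x₁ p₂ x₂ : ℝ) : Continuous (fs ν p₁ x₁ p₂ x₂) := by
  have := ramp_continuous x₁
  have := ramp_continuous x₂
  unfold fs; fun_prop

lemma fs_int (ν p₁ x₁ p₂ x₂ : ℝ) : IntegrableOn (fs ν p₁ x₁ p₂ x₂) (Ioi 0) :=
  (((ramp_integrableOn x₁).const_mul p₁).add ((ramp_integrableOn x₂).const_mul p₂)).const_mul ν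

lemma fs_integral (ν p₁ p₂ : ℝ) {x₁ x₂ : ℝ} (h1 : 0 ≤ x₁) (h2 : 0 ≤ x₂) :
    ∫ x in Ioi 0, fs ν p₁ x₁ p₂ x₂ x = ν * (p₁ * x₁ ^ 2 + p₂ * x₂ ^ 2) / 2 := by
  unfold fs
  rw [integral_const_mul, integral_add ((ramp_integrableOn x₁).const_mul p₁)
    ((ramp_integrableOn x₂).const_mul p₂), integral_const_mul, integral_const_mul,
    integral_ramp h1, integral_ramp h2]
  ring

lemma fs_integral_Ioc (ν p₁ p₂ : ℝ) {x₁ x₂ c : ℝ} (h1 : 0 ≤ x₁) (h2 : x₁ ≤ c) (h3 : c ≤ x₂) :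
    ∫ x in Ioc 0 c, fs ν p₁ x₁ p₂ x₂ x =
      ν * (p₁ * x₁ ^ 2 + p₂ * x₂ ^ 2 - p₂ * (x₂ - c) ^ 2) / 2 := by
  have hs : Ioc (0:ℝ) c ⊆ Ioi 0 := fun x hx => hx.1
  unfold fs
  rw [integral_const_mul, integral_add (((ramp_integrableOn x₁).mono_set hs).const_mul p₁)
    (((ramp_integrableOn x₂).mono_set hs).const_mul p₂), integral_const_mul, integral_const_mul,
    integral_ramp_Ioc h1 h2, integral_ramp_Ioc' (h1.trans h2) h3]
  ring

lemma fs_integral_mul {k : ℝ → ℝ} {M : ℝ} (hk0 : ∀ x, 0 ≤ k x) (hkM : ∀ x, k x ≤ M)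
    (hkm : AEStronglyMeasurable k (volume.restrict (Ioi 0))) (ν p₁ x₁ p₂ x₂ : ℝ) :
    ∫ x in Ioi 0, k x * fs ν p₁ x₁ p₂ x₂ x =
      ν * (p₁ * (∫ x in Ioi 0, k x * ramp x₁ x) + p₂ * (∫ x in Ioi 0, k x * ramp x₂ x)) := by
  have i1 := bdd_mul_int hk0 hkM hkm (ramp_integrableOn x₁)
  have i2 := bdd_mul_int hk0 hkM hkm (ramp_integrableOn x₂)
  have : ∀ x, k x * fs ν p₁ x₁ p₂ x₂ x =
      ν * (p₁ * (k x * ramp x₁ x) + p₂ * (k x * ramp x₂ x)) := by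
    intro x; unfold fs; ring
  simp_rw [this]
  rw [integral_const_mul, integral_add (i1.const_mul p₁) (i2.const_mul p₂), integral_const_mul,
    integral_const_mul]

lemma fs_low {ν p₁ x₁ p₂ x₂ ω x : ℝ} (hp : p₁ + p₂ = 1) (hm : p₁ * x₁ + p₂ * x₂ = ω)
    (h12 : x₁ ≤ x₂) (hx : x ≤ x₁) : fs ν p₁ x₁ p₂ x₂ x = ν * (ω - x) := by
  unfold fs
  rw [ramp_of_le hx, ramp_of_le (hx.trans h12)]
  have : p₁ * (x₁ - x) + p₂ * (x₂ - x) = (p₁ * x₁ + p₂ * x₂) - (p₁ + p₂) * x := by ring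
  rw [this, hp, hm]; ring

lemma fs_mid {ν p₁ x₁ p₂ x₂ x : ℝ} (hx : x₁ ≤ x) (hx2 : x ≤ x₂) :
    fs ν p₁ x₁ p₂ x₂ x = ν * p₂ * (x₂ - x) := by
  unfold fs
  rw [ramp_of_ge hx, ramp_of_le hx2]; ring

lemma fs_high {ν p₁ x₁ p₂ x₂ x : ℝ} (h12 : x₁ ≤ x₂) (hx2 : x₂ ≤ x) :
    fs ν p₁ x₁ p₂ x₂ x = 0 := by
  unfold fs
  rw [ramp_of_ge hx2, ramp_of_ge (h12.trans hx2)]; ring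

lemma diff_concave {ν p₁ x₁ p₂ x₂ : ℝ} {g : ℝ → ℝ} (hg : ConvexOn ℝ (Ici 0) g) (h1 : 0 ≤ x₁) :
    ConcaveOn ℝ (Icc x₁ x₂) (fun x => fs ν p₁ x₁ p₂ x₂ x - g x) := by
  have hsub : Icc x₁ x₂ ⊆ Ici (0:ℝ) := fun x hx => h1.trans hx.1
  have hg' := hg.subset hsub (convex_Icc _ _)
  refine ⟨convex_Icc _ _, ?_⟩
  intro x hx y hy p q hp hq hpq
  have hz := (convex_Icc x₁ x₂) hx hy hp hq hpq
  have := hg'.2 hx hy hp hq hpq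
  simp only
  rw [fs_mid hx.1 hx.2, fs_mid hy.1 hy.2, fs_mid hz.1 hz.2]
  simp only [smul_eq_mul] at *
  have hq' : q = 1 - p := by linarith
  subst hq'
  nlinarith

/-- If `D ≤ 0` on `(p, ∞)`, continuous and negative at `p`, then its integral is negative. -/
lemma neg_right {D : ℝ → ℝ} {p : ℝ} (hD : ContinuousOn D (Ici p)) (hi : IntegrableOn D (Ioi p))
    (hneg : ∀ x, p < x → D x ≤ 0) (hp : ∃ y, p ≤ y ∧ D y < 0) : ∫ x in Ioi p, D x < 0 := by
  obtain ⟨y, hy, hDy⟩ := hp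
  have hpy : p < y + 1 := by linarith
  rw [← Ioc_union_Ioi_eq_Ioi hpy.le, setIntegral_union (Ioc_disjoint_Ioi le_rfl) measurableSet_Ioi
    (hi.mono_set (fun x hx => hx.1)) (hi.mono_set (fun x hx => hpy.trans hx))]
  have h1 : 0 < ∫ x in p..(y + 1), - D x := by
    apply intervalIntegral.integral_pos hpy
    · exact (hD.mono (fun x hx => hx.1)).neg
    · intro x hx; have := hneg x hx.1; linarith
    · exact ⟨y, ⟨hy, by linarith⟩, by linarith⟩
  rw [intervalIntegral.integral_neg, intervalIntegral.integral_of_le hpy.le] at h1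
  have h2 : ∫ x in Ioi (y + 1), D x ≤ 0 :=
    setIntegral_nonpos measurableSet_Ioi (fun x hx => hneg x (hpy.trans hx))
  linarith

lemma neg_left {D : ℝ → ℝ} {q : ℝ} (hq : 0 < q) (hD : ContinuousOn D (Icc 0 q))
    (hneg : ∀ x, 0 < x → x ≤ q → D x ≤ 0) (hp : ∃ y, 0 ≤ y ∧ y ≤ q ∧ D y < 0) :
    ∫ x in Ioc 0 q, D x < 0 := by
  obtain ⟨y, hy, hyq, hDy⟩ := hp
  have h1 : 0 < ∫ x in (0:ℝ)..q, - D x := by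
    apply intervalIntegral.integral_pos hq
    · exact hD.neg
    · intro x hx; have := hneg x hx.1 hx.2; linarith
    · exact ⟨y, ⟨hy, hyq⟩, by linarith⟩
  rw [intervalIntegral.integral_neg, intervalIntegral.integral_of_le hq.le] at h1
  linarith

lemma dominate {ν ω ρ c M p₁ p₂ x₁ x₂ : ℝ} {g k : ℝ → ℝ} (hg : Adm ν ω ρ g)
    (hk0 : ∀ x, 0 ≤ k x) (hkM : ∀ x, k x ≤ M)
    (hkm : AEStronglyMeasurable k (volume.restrict (Ioi 0)))
    (hmono : MonotoneOn k (Ico 0 c)) (hanti : AntitoneOn k (Ioi c))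
    (hp : p₁ + p₂ = 1) (hm : p₁ * x₁ + p₂ * x₂ = ω) (hs : p₁ * x₁ ^ 2 + p₂ * x₂ ^ 2 = ρ)
    (h1 : 0 ≤ x₁) (h1c : x₁ ≤ c) (h2c : c ≤ x₂)
    (hc : ∫ x in Ioc 0 c, fs ν p₁ x₁ p₂ x₂ x = ∫ x in Ioc 0 c, g x) :
    ∫ x in Ioi 0, k x * g x ≤ ∫ x in Ioi 0, k x * fs ν p₁ x₁ p₂ x₂ x := by
  have h12 : x₁ ≤ x₂ := h1c.trans h2c
  have hc0 : 0 ≤ c := h1.trans h1c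
  set D : ℝ → ℝ := fun x => fs ν p₁ x₁ p₂ x₂ x - g x with hDdef
  have hDi : IntegrableOn D (Ioi 0) := (fs_int ν p₁ x₁ p₂ x₂).sub hg.intg
  have hDc : ContinuousOn D (Ici 0) := (fs_cont ν p₁ x₁ p₂ x₂).continuousOn.sub hg.cont
  have hconc : ConcaveOn ℝ (Icc x₁ x₂) D := diff_concave hg.conv h1
  have hs1 : Ioc (0:ℝ) c ⊆ Ioi 0 := fun x hx => hx.1
  have hs2 : Ioi c ⊆ Ioi (0:ℝ) := fun x hx => lt_of_le_of_lt hc0 hx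
  have hDl : ∫ x in Ioc 0 c, D x = 0 := by
    rw [integral_sub ((fs_int _ _ _ _ _).mono_set hs1) (hg.intg.mono_set hs1), hc, sub_self]
  have hDt : ∫ x in Ioi 0, D x = 0 := by
    rw [integral_sub (fs_int _ _ _ _ _) hg.intg, fs_integral _ _ _ h1 (h1.trans h12), hs,
      hg.integral, sub_self]
  have hsplit : ∀ F : ℝ → ℝ, IntegrableOn F (Ioi 0) →
      ∫ x in Ioi 0, F x = (∫ x in Ioc 0 c, F x) + ∫ x in Ioi c, F x := by
    intro F hF
    rw [← setIntegral_union (Ioc_disjoint_Ioi le_rfl) measurableSet_Ioi (hF.mono_set hs1)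
      (hF.mono_set hs2), Ioc_union_Ioi_eq_Ioi hc0]
  have hDr : ∫ x in Ioi c, D x = 0 := by
    have := hsplit D hDi
    linarith
  have hlow : ∀ x, 0 ≤ x → x ≤ x₁ → D x ≤ 0 := by
    intro x hx hx1
    have := hg.lower x hx
    simp only [hDdef]
    rw [fs_low hp hm h12 hx1]; linarith
  have hhigh : ∀ x, x₂ ≤ x → D x ≤ 0 := by
    intro x hx
    have := hg.nonneg x ((hc0.trans h2c).trans hx)
    simp only [hDdef]
    rw [fs_high h12 hx]; linarith
  have hposm : ∀ x, 0 ≤ x → 0 < D x → x₁ < x ∧ x < x₂ := by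
    intro x hx hDx
    constructor
    · by_contra hh; have := hlow x hx (by linarith); linarith
    · by_contra hh; have := hhigh x (by linarith); linarith
  have hDcn : 0 ≤ D c := by
    by_contra hneg
    push Not at hneg
    obtain ⟨y, hy, hDy⟩ : ∃ y, c < y ∧ 0 < D y := by
      by_contra hh
      push Not at hh
      have := neg_right (hDc.mono (fun x hx => hc0.trans hx)) (hDi.mono_set hs2) hh ⟨c, le_rfl, hneg⟩
      linarith
    obtain ⟨x, hx0, hx, hDx⟩ : ∃ x, 0 ≤ x ∧ x ≤ c ∧ 0 ≤ D x := by
      rcases hc0.eq_or_lt with h0 | h0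
      · refine ⟨0, le_rfl, hc0, ?_⟩
        simp only [hDdef]
        rw [fs_low hp hm h12 h1, hg.zero]; simp
      · by_contra hh
        push Not at hh
        have := neg_left h0 (hDc.mono (fun x hx => hx.1)) (fun x hx hx' => (hh x hx.le hx').le)
          ⟨c, hc0, le_rfl, hneg⟩
        linarith
    by_cases hxx : x₁ ≤ x
    · have := hconc.min_le_of_mem_Icc ⟨hxx, hx.trans h2c⟩
        ⟨h1c.trans hy.le, (hposm y (hc0.trans hy.le) hDy).2.le⟩ ⟨hx, hy.le⟩
      have h3 := le_min hDx hDy.le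
      linarith
    · -- then there is a positive point unless `D` vanishes on the left
      push Not at hxx
      have hx1c : ∃ z, x₁ ≤ z ∧ z ≤ c ∧ 0 ≤ D z := by
        by_contra hh
        push Not at hh
        have := neg_left (lt_of_le_of_lt hx0 (hxx.trans_le h1c)) (hDc.mono (fun x hx => hx.1))
          (fun x hx hx' => by
            rcases le_total x x₁ with h | h
            · exact hlow x hx.le h
            · exact (hh x h hx').le) ⟨c, hc0, le_rfl, hneg⟩
        linarith
      obtain ⟨z, hz1, hz, hDz⟩ := hx1c
      have := hconc.min_le_of_mem_Icc ⟨hz1, hz.trans h2c⟩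
        ⟨h1c.trans hy.le, (hposm y (hc0.trans hy.le) hDy).2.le⟩ ⟨hz, hy.le⟩
      have h3 := le_min hDz hDy.le
      linarith
  have hkDi : IntegrableOn (fun x => k x * D x) (Ioi 0) := bdd_mul_int hk0 hkM hkm hDi
  have hL : 0 ≤ ∫ x in Ioo 0 c, k x * D x := by
    have hs3 : Ioo (0:ℝ) c ⊆ Ioi 0 := fun x hx => hx.1
    refine corr_nonneg measurableSet_Ioo hk0 hkM (hDi.mono_set hs3) (hkDi.mono_set hs3) ?_ ?_
    · rw [← integral_Ioc_eq_integral_Ioo]; exact hDl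
    · intro x hx y hy hDy hDx
      apply hmono ⟨hy.1.le, hy.2⟩ ⟨hx.1.le, hx.2⟩
      by_contra hh
      push Not at hh
      have hx' := hposm x hx.1.le hDx
      have := hconc.min_le_of_mem_Icc ⟨hx'.1.le, hx'.2.le⟩ ⟨h1c, h2c⟩ ⟨hh.le, hy.2.le⟩
      have h3 := le_min hDx.le hDcn
      linarith
  have hR : 0 ≤ ∫ x in Ioi c, k x * D x := by
    refine corr_nonneg measurableSet_Ioi hk0 hkM (hDi.mono_set hs2) (hkDi.mono_set hs2) hDr ?_
    intro x hx y hy hDy hDx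
    apply hanti hx hy
    by_contra hh
    push Not at hh
    have hx' := hposm x (hs2 hx).le hDx
    have := hconc.min_le_of_mem_Icc ⟨h1c, h2c⟩ ⟨hx'.1.le, hx'.2.le⟩ ⟨le_of_lt hy, hh.le⟩
    have h3 := le_min hDcn hDx.le
    linarith
  have htot := hsplit _ hkDi
  rw [integral_Ioc_eq_integral_Ioo] at htot
  have e : ∀ x, k x * D x = k x * fs ν p₁ x₁ p₂ x₂ x - k x * g x := by
    intro x; simp only [hDdef]; ring
  simp_rw [e] at htot hL hR
  rw [integral_sub (bdd_mul_int hk0 hkM hkm (fs_int _ _ _ _ _))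
    (bdd_mul_int hk0 hkM hkm hg.intg)] at htot
  linarith

/-! ### Two-point parameters -/

lemma tp_pos {x ω ρ : ℝ} (hx : x < ω) (hρ : ω ^ 2 ≤ ρ) : 0 < ρ - 2 * ω * x + x ^ 2 := by
  nlinarith [sq_pos_of_pos (sub_pos.2 hx)]

lemma tp_sum {x ω ρ : ℝ} (hx : x < ω) (hρ : ω ^ 2 ≤ ρ) :
    (ρ - ω ^ 2) / (ρ - 2 * ω * x + x ^ 2) + (ω - x) ^ 2 / (ρ - 2 * ω * x + x ^ 2) = 1 := by
  have := (tp_pos hx hρ).ne'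
  obtain ⟨q, hq⟩ : ∃ q, q = ρ - 2 * ω * x + x ^ 2 := ⟨_, rfl⟩
  rw [← hq] at this ⊢
  field_simp
  rw [hq]
  ring

lemma tp_mean {x ω ρ : ℝ} (hx : x < ω) (hρ : ω ^ 2 ≤ ρ) :
    (ρ - ω ^ 2) / (ρ - 2 * ω * x + x ^ 2) * x +
      (ω - x) ^ 2 / (ρ - 2 * ω * x + x ^ 2) * ((ρ - ω * x) / (ω - x)) = ω := by
  have := (tp_pos hx hρ).ne'
  have h2 : ω - x ≠ 0 := (sub_pos.2 hx).ne'
  obtain ⟨q, hq⟩ : ∃ q, q = ρ - 2 * ω * x + x ^ 2 := ⟨_, rfl⟩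
  rw [← hq] at this ⊢
  field_simp
  rw [hq]
  ring

lemma tp_sq {x ω ρ : ℝ} (hx : x < ω) (hρ : ω ^ 2 ≤ ρ) :
    (ρ - ω ^ 2) / (ρ - 2 * ω * x + x ^ 2) * x ^ 2 +
      (ω - x) ^ 2 / (ρ - 2 * ω * x + x ^ 2) * ((ρ - ω * x) / (ω - x)) ^ 2 = ρ := by
  have := (tp_pos hx hρ).ne'
  have h2 : ω - x ≠ 0 := (sub_pos.2 hx).ne'
  obtain ⟨q, hq⟩ : ∃ q, q = ρ - 2 * ω * x + x ^ 2 := ⟨_, rfl⟩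
  rw [← hq] at this ⊢
  field_simp
  rw [hq]
  ring

lemma tp_x2 {x ω ρ : ℝ} (hx : x < ω) (hρ : ω ^ 2 ≤ ρ) : ω ≤ (ρ - ω * x) / (ω - x) := by
  rw [le_div_iff₀ (sub_pos.2 hx)]
  nlinarith

lemma tp_shift {x ω ρ c : ℝ} (hx : x < ω) (hρ : ω ^ 2 ≤ ρ) :
    (ω - x) ^ 2 / (ρ - 2 * ω * x + x ^ 2) * ((ρ - ω * x) / (ω - x) - c) ^ 2
      = (ρ - c * ω - (ω - c) * x) ^ 2 / (ρ - 2 * ω * x + x ^ 2) := by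
  have := (tp_pos hx hρ).ne'
  have h2 : ω - x ≠ 0 := (sub_pos.2 hx).ne'
  field_simp
  ring

/-- The two-point tail with moments `ω`, `ρ` and lower atom `x`. -/
noncomputable def tp (ν ω ρ x : ℝ) : ℝ → ℝ :=
  fs ν ((ρ - ω ^ 2) / (ρ - 2 * ω * x + x ^ 2)) x ((ω - x) ^ 2 / (ρ - 2 * ω * x + x ^ 2))
    ((ρ - ω * x) / (ω - x))

lemma tp_Ioc {ν ω ρ x c : ℝ} (h0 : 0 ≤ x) (hx : x < ω) (hρ : ω ^ 2 ≤ ρ) (hxc : x ≤ c)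
    (hc2 : c ≤ (ρ - ω * x) / (ω - x)) :
    ∫ y in Ioc 0 c, tp ν ω ρ x y =
      ν / 2 * (ρ - (ρ - c * ω - (ω - c) * x) ^ 2 / (ρ - 2 * ω * x + x ^ 2)) := by
  unfold tp
  rw [fs_integral_Ioc _ _ _ h0 hxc hc2, tp_sq hx hρ, tp_shift hx hρ]
  ring

lemma exists_x1 {ν ω ρ c : ℝ} {g : ℝ → ℝ} (hν : 0 < ν) (hω : 0 < ω) (hg : Adm ν ω ρ g)
    (hρ : ω ^ 2 < ρ) (hc0 : 0 ≤ c) :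
    ∃ x, 0 ≤ x ∧ x < ω ∧ x ≤ c ∧ c ≤ (ρ - ω * x) / (ω - x) ∧
      ∫ y in Ioc 0 c, tp ν ω ρ x y = ∫ y in Ioc 0 c, g y := by
  have hρ0 : 0 < ρ := lt_of_le_of_lt (sq_nonneg ω) hρ
  set Φ : ℝ → ℝ := fun x =>
    ν / 2 * (ρ - (ρ - c * ω - (ω - c) * x) ^ 2 / (ρ - 2 * ω * x + x ^ 2)) with hΦ
  have hq : ∀ x, 0 < ρ - 2 * ω * x + x ^ 2 := by
    intro x; nlinarith [sq_nonneg (ω - x)]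
  have hΦc : Continuous Φ := by
    simp only [hΦ]
    refine continuous_const.mul (continuous_const.sub (Continuous.div ?_ ?_ ?_))
    · fun_prop
    · fun_prop
    · intro x; exact (hq x).ne'
  have hs1 : Ioc (0:ℝ) c ⊆ Ioi 0 := fun x hx => hx.1
  have hs2 : Ioi c ⊆ Ioi (0:ℝ) := fun x hx => lt_of_le_of_lt hc0 hx
  have hsplit : ∀ F : ℝ → ℝ, IntegrableOn F (Ioi 0) →
      ∫ x in Ioi 0, F x = (∫ x in Ioc 0 c, F x) + ∫ x in Ioi c, F x := by
    intro F hF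
    rw [← setIntegral_union (Ioc_disjoint_Ioi le_rfl) measurableSet_Ioi (hF.mono_set hs1)
      (hF.mono_set hs2), Ioc_union_Ioi_eq_Ioi hc0]
  have hgtail : 0 ≤ ∫ y in Ioi c, g y :=
    setIntegral_nonneg measurableSet_Ioi (fun x hx => hg.nonneg x (hs2 hx).le)
  have hgsplit := hsplit g hg.intg
  -- the starting point
  obtain ⟨s, hs0, hsω, hsc, hsΦ, hsx2⟩ : ∃ s, 0 ≤ s ∧ s < ω ∧ s ≤ c ∧
      (∫ y in Ioc 0 c, g y) ≤ Φ s ∧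
      (∀ x, s ≤ x → x < ω → c ≤ (ρ - ω * x) / (ω - x)) := by
    rcases le_or_gt ρ (c * ω) with h | h
    · have hcω : ω < c := by nlinarith
      have hd : 0 < c - ω := by linarith
      have hsω : (c * ω - ρ) / (c - ω) < ω := by
        rw [div_lt_iff₀ hd]; nlinarith
      refine ⟨(c * ω - ρ) / (c - ω), div_nonneg (by linarith) hd.le, hsω, by linarith, ?_, ?_⟩
      · have : ρ - c * ω - (ω - c) * ((c * ω - ρ) / (c - ω)) = 0 := by
          field_simp; ring
        simp only [hΦ, this]
        rw [hg.integral] at hgsplit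
        simp
        linarith
      · intro x hx hxω
        rw [div_le_iff₀ hd] at hx
        rw [le_div_iff₀ (sub_pos.2 hxω)]
        nlinarith
    · have hx2 : ∀ x, 0 ≤ x → x < ω → c ≤ (ρ - ω * x) / (ω - x) := by
        intro x hx hxω
        rw [le_div_iff₀ (sub_pos.2 hxω)]
        rcases le_total ω c with h' | h'
        · nlinarith
        · nlinarith
      refine ⟨0, le_rfl, hω, hc0, ?_, hx2⟩
      have hx20 := hx2 0 le_rfl hω
      have e := tp_Ioc (ν := ν) le_rfl hω hρ.le hc0 hx20
      have : Φ 0 = ∫ y in Ioc 0 c, tp ν ω ρ 0 y := e.symm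
      rw [this]
      by_contra hlt
      push Not at hlt
      set X := (ρ - ω * 0) / (ω - 0) with hX
      set D : ℝ → ℝ := fun x => tp ν ω ρ 0 x - g x with hD
      have htpi : IntegrableOn (tp ν ω ρ 0) (Ioi 0) := fs_int _ _ _ _ _
      have htpt : ∫ y in Ioi 0, tp ν ω ρ 0 y = ν * ρ / 2 := by
        unfold tp
        rw [fs_integral _ _ _ le_rfl (hc0.trans hx20), tp_sq hω hρ.le]
      have hconc : ConcaveOn ℝ (Icc 0 X) D := diff_concave hg.conv le_rfl
      have hD0 : D 0 = 0 := by
        simp only [hD]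
        unfold tp
        rw [fs_low (tp_sum hω hρ.le) (tp_mean hω hρ.le) (hc0.trans hx20) le_rfl, hg.zero]
        ring
      have hDl : ∫ x in Ioc 0 c, D x < 0 := by
        rw [integral_sub (htpi.mono_set hs1) (hg.intg.mono_set hs1)]; linarith
      obtain ⟨y, hy, hDy⟩ : ∃ y ∈ Ioc 0 c, D y < 0 := by
        by_contra hh
        push Not at hh
        have := setIntegral_nonneg (μ := volume) measurableSet_Ioc hh
        linarith
      have hDr : ∫ x in Ioi c, D x ≤ 0 := by
        apply setIntegral_nonpos measurableSet_Ioi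
        intro z hz
        have hz0 : 0 ≤ z := (hs2 hz).le
        rcases le_total X z with h1 | h1
        · simp only [hD]
          unfold tp
          rw [fs_high (hc0.trans hx20) h1]
          linarith [hg.nonneg z hz0]
        · by_contra hpos
          push Not at hpos
          have := hconc.min_le_of_mem_Icc ⟨le_rfl, hc0.trans hx20⟩ ⟨hz0, h1⟩
            ⟨hy.1.le, hy.2.trans (le_of_lt hz)⟩
          rw [hD0, min_eq_left hpos.le] at this
          linarith
      have := hsplit D (htpi.sub hg.intg)
      rw [integral_sub htpi hg.intg, htpt, hg.integral] at this
      linarith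
  -- the end point
  have hcg : ContinuousOn g (Icc 0 c) := hg.cont.mono (fun x hx => hx.1)
  have hend : Φ (min c ω) ≤ ∫ y in Ioc 0 c, g y := by
    have h1 : ∫ y in Ioc 0 c, ν * ramp ω y ≤ ∫ y in Ioc 0 c, g y :=
      setIntegral_mono_on (((ramp_integrableOn ω).mono_set hs1).const_mul ν)
        (hg.intg.mono_set hs1) measurableSet_Ioc (fun x hx => hg.lower' hν hx.1.le)
    rw [integral_const_mul] at h1
    refine le_trans (le_of_eq ?_) h1
    rcases le_total c ω with h | h
    · rw [min_eq_left h, integral_ramp_Ioc' hc0 h]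
      simp only [hΦ]
      have := hq c
      have e : ρ - c * ω - (ω - c) * c = ρ - 2 * ω * c + c ^ 2 := by ring
      rw [e]
      field_simp
      ring
    · rw [min_eq_right h, integral_ramp_Ioc hω.le h]
      simp only [hΦ]
      have := hq ω
      have e : ρ - c * ω - (ω - c) * ω = ρ - 2 * ω * ω + ω ^ 2 := by ring
      rw [e]
      field_simp
      ring
  obtain ⟨x, hx, hxΦ⟩ := intermediate_value_Icc' (le_min hsc hsω.le) hΦc.continuousOn ⟨hend, hsΦ⟩
  have hx0 : 0 ≤ x := hs0.trans hx.1
  have hxc : x ≤ c := hx.2.trans (min_le_left _ _)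
  have hxω : x < ω := by
    refine lt_of_le_of_ne (hx.2.trans (min_le_right _ _)) ?_
    rintro rfl
    have hΦω : Φ x = ν * x ^ 2 / 2 := by
      simp only [hΦ]
      have := hq x
      have e : ρ - c * x - (x - c) * x = ρ - 2 * x * x + x ^ 2 := by ring
      rw [e]
      field_simp
      ring
    rw [hΦω] at hxΦ
    have hcpos : 0 < c := lt_of_lt_of_le hω hxc
    have hgc : g c = 0 := by
      by_contra hne
      have hpos : 0 < g c := lt_of_le_of_ne (hg.nonneg c hc0) (Ne.symm hne)
      have := neg_left (D := fun y => ν * ramp x y - g y) hcpos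
        (((ramp_continuous x).const_mul ν).continuousOn.sub hcg)
        (fun y hy _ => by have := hg.lower' hν hy.le; linarith)
        ⟨c, hc0, le_rfl, by rw [ramp_of_ge hxc]; linarith⟩
      rw [integral_sub (((ramp_integrableOn x).mono_set hs1).const_mul ν)
        (hg.intg.mono_set hs1), integral_const_mul, integral_ramp_Ioc hω.le hxc] at this
      linarith
    have htail : ∫ y in Ioi c, g y ≤ 0 := by
      apply setIntegral_nonpos measurableSet_Ioi
      intro y hy
      have := hg.anti (mem_Ici.2 hc0) (mem_Ici.2 (le_of_lt (hs2 hy))) (le_of_lt hy)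
      linarith
    rw [hg.integral] at hgsplit
    nlinarith
  have hc2 := hsx2 x hx.1 hxω
  refine ⟨x, hx0, hxω, hxc, hc2, ?_⟩
  rw [tp_Ioc hx0 hxω hρ.le hxc hc2]
  exact hxΦ

/-! ### The upper bound -/

lemma lam_bound {k : ℝ → ℝ} {M lam : ℝ} (hk0 : ∀ x, 0 ≤ k x) (hkM : ∀ x, k x ≤ M)
    (hkm : AEStronglyMeasurable k (volume.restrict (Ioi 0)))
    (hmono : MonotoneOn k (Ici 0))
    (hlam : Tendsto (fun y => (∫ x in Ioi 0, k x * ramp y x) / y ^ 2) atTop (𝓝 lam))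
    {x₀ : ℝ} (hx₀ : 0 < x₀) : k x₀ ≤ 2 * lam := by
  have h1 : ∀ y, 0 < y → k x₀ * (1 / 2 - 2 * x₀ * y⁻¹) ≤
      (∫ x in Ioi 0, k x * ramp y x) / y ^ 2 := by
    intro y hy
    have i1 : IntegrableOn (fun x => ramp y x - y / x₀ * ramp (2 * x₀) x) (Ioi 0) :=
      (ramp_integrableOn y).sub ((ramp_integrableOn (2 * x₀)).const_mul _)
    have h2 : ∫ x in Ioi 0, k x₀ * (ramp y x - y / x₀ * ramp (2 * x₀) x) ≤
        ∫ x in Ioi 0, k x * ramp y x := by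
      apply setIntegral_mono_on (i1.const_mul _)
        (bdd_mul_int hk0 hkM hkm (ramp_integrableOn y)) measurableSet_Ioi
      intro x hx
      have hx' : (0:ℝ) < x := hx
      have r1 := ramp_nonneg y x
      have r2 := ramp_nonneg (2 * x₀) x
      have r3 : 0 ≤ y / x₀ * ramp (2 * x₀) x := by positivity
      rcases le_total x₀ x with h | h
      · have := hmono (mem_Ici.2 hx₀.le) (mem_Ici.2 hx'.le) h
        have := hk0 x₀
        nlinarith
      · have e1 : x₀ ≤ ramp (2 * x₀) x := le_trans (by linarith) (le_ramp _ _)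
        have e2 : y ≤ y / x₀ * ramp (2 * x₀) x := by
          calc y = y / x₀ * x₀ := by field_simp
            _ ≤ _ := by gcongr
        have e3 : ramp y x ≤ y := by
          unfold ramp; exact max_le (by linarith) hy.le
        have := hk0 x₀
        have := mul_nonneg (hk0 x) r1
        nlinarith
    rw [integral_const_mul, integral_sub (ramp_integrableOn y)
      ((ramp_integrableOn (2 * x₀)).const_mul _), integral_const_mul, integral_ramp hy.le,
      integral_ramp (by positivity)] at h2
    rw [le_div_iff₀ (by positivity)]
    refine le_trans (le_of_eq ?_) h2
    field_simp
  have h3 : Tendsto (fun y : ℝ => k x₀ * (1 / 2 - 2 * x₀ * y⁻¹)) atTop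
      (𝓝 (k x₀ * (1 / 2 - 2 * x₀ * 0))) :=
    ((tendsto_inv_atTop_zero.const_mul _).const_sub _).const_mul _
  have := le_of_tendsto_of_tendsto h3 hlam
    ((eventually_gt_atTop 0).mono (fun y hy => h1 y hy))
  linarith

/-- Unimodality in shifted coordinates. -/
def Unimod (k : ℝ → ℝ) : Prop :=
  MonotoneOn k (Ici 0) ∨ ∃ c, 0 ≤ c ∧ MonotoneOn k (Ico 0 c) ∧ AntitoneOn k (Ioi c)

lemma unimod_of {a : ℝ} {h : ℝ → ℝ} (hquasi : ∃ c : EReal, (a : EReal) ≤ c ∧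
      MonotoneOn h {x : ℝ | a ≤ x ∧ (x : EReal) < c} ∧
      AntitoneOn h {x : ℝ | c < (x : EReal)}) : Unimod (fun x => h (x + a)) := by
  obtain ⟨c, hc, hm, han⟩ := hquasi
  induction c with
  | bot => simp at hc
  | top =>
    left
    intro x hx y hy hxy
    have hx' : (0:ℝ) ≤ x := hx
    have hy' : (0:ℝ) ≤ y := hy
    exact hm ⟨by linarith, EReal.coe_lt_top _⟩ ⟨by linarith, EReal.coe_lt_top _⟩ (by linarith)
  | coe c =>
    right
    have hc' : a ≤ c := by exact_mod_cast hc
    refine ⟨c - a, by linarith, ?_, ?_⟩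
    · intro x hx y hy hxy
      refine hm ⟨by linarith [hx.1], ?_⟩ ⟨by linarith [hy.1], ?_⟩ (by linarith)
      · have := hx.2
        exact_mod_cast (by linarith : x + a < c)
      · have := hy.2
        exact_mod_cast (by linarith : y + a < c)
    · intro x hx y hy hxy
      have hx' : c - a < x := hx
      have hy' : c - a < y := hy
      refine han ?_ ?_ (by linarith : x + a ≤ y + a)
      · show (c : EReal) < ((x + a : ℝ) : EReal)
        exact_mod_cast (by linarith : c < x + a)
      · show (c : EReal) < ((y + a : ℝ) : EReal)
        exact_mod_cast (by linarith : c < y + a)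

lemma Unimod.meas {k : ℝ → ℝ} (hk : Unimod k) :
    AEStronglyMeasurable k (volume.restrict (Ioi 0)) := by
  rcases hk with hk | ⟨c, hc, h1, h2⟩
  · exact (aemeasurable_restrict_of_monotoneOn measurableSet_Ioi
      (hk.mono Ioi_subset_Ici_self)).aestronglyMeasurable
  · have m1 : AEStronglyMeasurable k (volume.restrict (Ico 0 c)) :=
      (aemeasurable_restrict_of_monotoneOn measurableSet_Ico h1).aestronglyMeasurable
    have m2 : AEStronglyMeasurable k (volume.restrict (Ioi c)) :=
      (aemeasurable_restrict_of_antitoneOn measurableSet_Ioi h2).aestronglyMeasurable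
    have m3 : AEStronglyMeasurable k (volume.restrict (Ioc 0 c)) := by
      rw [Measure.restrict_congr_set (Ico_ae_eq_Ioc (μ := volume)).symm]
      exact m1
    have := aestronglyMeasurable_union_iff.2 ⟨m3, m2⟩
    rwa [Ioc_union_Ioi_eq_Ioi hc] at this

lemma bdd_intOn {k : ℝ → ℝ} {M : ℝ} (hk0 : ∀ x, 0 ≤ k x) (hkM : ∀ x, k x ≤ M)
    (hkm : AEStronglyMeasurable k (volume.restrict (Ioi 0))) (y : ℝ) :
    IntegrableOn k (Ioc 0 y) := by
  have hs : Ioc (0:ℝ) y ⊆ Ioi 0 := fun x hx => hx.1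
  have := bdd_mul_int (S := Ioc 0 y) (g := fun _ => (1:ℝ)) hk0 hkM
    (hkm.mono_measure (Measure.restrict_mono hs le_rfl)) (by simp)
  simpa using this

lemma upper_Wcal {a ν lam ω ρ M : ℝ} {h g : ℝ → ℝ} (hν : 0 < ν) (hω : 0 < ω)
    (hk0 : ∀ x, 0 ≤ h x) (hkM : ∀ x, h x ≤ M) (hu : Unimod (fun x => h (x + a)))
    (hlam : Tendsto (fun x => Hfun a h x / x ^ 2) atTop (𝓝 lam)) (hg : Adm ν ω ρ g) :
    ∃ x₁ ∈ Icc (0:ℝ) ω, ∫ x in Ioi 0, h (x + a) * g x ≤ Wcal a ν lam h x₁ ω ρ := by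
  have k0 : ∀ x, 0 ≤ (fun x => h (x + a)) x := fun x => hk0 _
  have kM : ∀ x, (fun x => h (x + a)) x ≤ M := fun x => hkM _
  have hH : ∀ y, 0 ≤ y → ∫ x in Ioi 0, h (x + a) * ramp y x = Hfun a h y := fun y hy =>
    integral_mul_ramp a h hy (bdd_intOn k0 kM hu.meas y)
  have hρ := hg.sq_le hν hω.le
  rcases hρ.eq_or_lt with heq | hlt
  · refine ⟨ω, ⟨hω.le, le_rfl⟩, ?_⟩
    have := hg.upper_const hν hω.le k0 kM hu.meas (C := M) (fun x _ => kM x)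
    rw [hH ω hω.le, ← heq] at this
    unfold Wcal
    rw [if_pos rfl, ← heq]
    refine this.trans (le_of_eq ?_)
    ring
  · rcases hu with hmono | ⟨c, hc, hm, han⟩
    · refine ⟨ω, ⟨hω.le, le_rfl⟩, ?_⟩
      have hkm := Unimod.meas (k := fun x => h (x + a)) (Or.inl hmono)
      have hlam' : Tendsto (fun y => (∫ x in Ioi 0, (fun x => h (x + a)) x * ramp y x) / y ^ 2)
          atTop (𝓝 lam) := by
        refine hlam.congr' ?_
        filter_upwards [eventually_ge_atTop 0] with y hy
        rw [← hH y hy]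
      have := hg.upper_const hν hω.le k0 kM hkm (C := 2 * lam)
        (fun x hx => lam_bound k0 kM hkm hmono hlam' hx)
      rw [hH ω hω.le] at this
      unfold Wcal
      rw [if_pos rfl]
      refine this.trans (le_of_eq ?_)
      ring
    · have hkm := Unimod.meas (k := fun x => h (x + a)) (Or.inr ⟨c, hc, hm, han⟩)
      obtain ⟨x, hx0, hxω, hxc, hcx, hIntg⟩ := exists_x1 hν hω hg hlt hc
      refine ⟨x, ⟨hx0, hxω.le⟩, ?_⟩
      have := dominate hg k0 kM hkm hm han (tp_sum hxω hρ) (tp_mean hxω hρ) (tp_sq hxω hρ)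
        hx0 hxc hcx hIntg
      rw [fs_integral_mul k0 kM hkm] at this
      rw [hH x hx0, hH _ (hc.trans hcx)] at this
      unfold Wcal
      rw [if_neg hxω.ne]
      exact this

/-! ### Shifting and scaling -/

lemma shift_integral (a : ℝ) (F : ℝ → ℝ) : ∫ x in Ioi a, F x = ∫ x in Ioi 0, F (x + a) := by
  have := (measurePreserving_add_right (volume : Measure ℝ) a).setIntegral_preimage_emb
    (measurableEmbedding_addRight a) F (Ioi a)
  rw [← this]
  congr 2
  ext x; simp

lemma shift_integrableOn (a : ℝ) (F : ℝ → ℝ) :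
    IntegrableOn F (Ioi a) ↔ IntegrableOn (fun x => F (x + a)) (Ioi 0) := by
  have := (measurePreserving_add_right (volume : Measure ℝ) a).integrableOn_comp_preimage
    (measurableEmbedding_addRight a) (f := F) (s := Ioi a)
  rw [← this]
  have e : (fun x => x + a) ⁻¹' Ioi a = Ioi 0 := by ext x; simp
  rw [e]
  rfl

lemma antitone_of {g : ℝ → ℝ} (hc : ConvexOn ℝ (Ici 0) g) (hn : ∀ x, 0 ≤ x → 0 ≤ g x)
    (hi : IntegrableOn g (Ioi 0)) : AntitoneOn g (Ici 0) := by
  intro x hx y hy hxy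
  by_contra hlt
  push Not at hlt
  have hx' : (0:ℝ) ≤ x := hx
  have hxy' : x < y := lt_of_le_of_ne hxy (by rintro rfl; exact lt_irrefl _ hlt)
  have hpos : 0 < g y := lt_of_le_of_lt (hn x hx) hlt
  have hge : ∀ z ∈ Ioi y, g y ≤ g z := by
    intro z hz
    have hz' : y < z := hz
    have := hc.slope_mono_adjacent hx (mem_Ici.2 (by linarith : (0:ℝ) ≤ z)) hxy' hz'
    have h1 : 0 < (g y - g x) / (y - x) := div_pos (by linarith) (by linarith)
    have h2 : 0 < (g z - g y) / (z - y) := lt_of_lt_of_le h1 this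
    have h3 := (div_pos_iff_of_pos_right (by linarith : 0 < z - y)).1 h2
    linarith
  have hi' : IntegrableOn g (Ioi y) := hi.mono_set (fun z hz => by
    have hz' : y < z := hz
    exact mem_Ioi.2 (by linarith))
  have hconst : IntegrableOn (fun _ : ℝ => g y) (Ioi y) := by
    refine Integrable.mono hi' aestronglyMeasurable_const ?_
    rw [ae_restrict_iff' measurableSet_Ioi]
    filter_upwards with z hz
    rw [Real.norm_eq_abs, Real.norm_eq_abs, abs_of_pos hpos]
    exact (hge z hz).trans (le_abs_self _)
  rw [integrableOn_const_iff] at hconst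
  simp [hpos.ne'] at hconst

lemma adm_of_feasible {a βl βu ηl ηu ν : ℝ} {f : ℝ → ℝ} (hν : 0 < ν)
    (hf : RFeasible a βl βu ηl ηu ν f) :
    Adm ν (f a / ν) (2 * (∫ x in Ioi a, f x) / ν) (fun x => f (x + a)) := by
  obtain ⟨hi, -, -, -, -, hcont, ⟨d, hd⟩, hder, hconv, hnn⟩ := hf
  have hdd : -ν ≤ d := by
    unfold rightDeriv at hder
    rwa [hd.derivWithin (uniqueDiffWithinAt_Ioi a)] at hder
  have hconv' : ConvexOn ℝ (Ici 0) (fun x => f (x + a)) := by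
    refine ⟨convex_Ici _, ?_⟩
    intro x hx y hy p q hp hq hpq
    have hx' : (0:ℝ) ≤ x := hx
    have hy' : (0:ℝ) ≤ y := hy
    have := hconv.2 (mem_Ici.2 (by linarith : a ≤ x + a)) (mem_Ici.2 (by linarith : a ≤ y + a))
      hp hq hpq
    have e : p • (x + a) + q • (y + a) = p • x + q • y + a := by
      simp only [smul_eq_mul]
      have : q = 1 - p := by linarith
      subst this; ring
    rw [e] at this
    exact this
  have hnn' : ∀ x, 0 ≤ x → 0 ≤ f (x + a) := fun x hx => hnn _ (by linarith)
  have hi' := (shift_integrableOn a f).1 hi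
  refine ⟨?_, hconv', hnn', ?_, ?_, hi', ?_, antitone_of hconv' hnn' hi'⟩
  · have hfc : ContinuousOn f (Ici a) := by
      intro x hx
      rcases (mem_Ici.1 hx).eq_or_lt with rfl | h
      · exact hcont
      · have h1 := hconv.continuousOn_interior
        rw [interior_Ici] at h1
        exact ((h1 x h).continuousAt (Ioi_mem_nhds h)).continuousWithinAt
    refine hfc.comp (by fun_prop) ?_
    intro x hx
    have hx' : (0:ℝ) ≤ x := hx
    exact mem_Ici.2 (by linarith)
  · simp only [zero_add]; field_simp
  · intro x hx
    rcases hx.eq_or_lt with rfl | h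
    · simp only [zero_add, sub_zero]; apply le_of_eq; field_simp
    · have := hconv.le_slope_of_hasDerivWithinAt_Ioi (mem_Ici.2 le_rfl)
        (mem_Ici.2 (by linarith : a ≤ x + a)) (by linarith) hd
      rw [slope_def_field] at this
      have e : x + a - a = x := by ring
      rw [e, le_div_iff₀ h] at this
      have e2 : ν * (f a / ν - x) = f a - ν * x := by field_simp
      rw [e2]
      nlinarith
  · rw [← shift_integral]; field_simp

lemma Adm.scale {ν ω ρ t : ℝ} {g : ℝ → ℝ} (hg : Adm ν ω ρ g) (ht : 0 < t) :
    Adm ν (t * ω) (t ^ 2 * ρ) (fun x => t * g (t⁻¹ * x)) := by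
  have ht' : 0 < t⁻¹ := inv_pos.2 ht
  have hpos : ∀ x, 0 ≤ x → 0 ≤ t⁻¹ * x := fun x hx => by positivity
  refine ⟨?_, ?_, ?_, ?_, ?_, ?_, ?_, ?_⟩
  · refine continuousOn_const.mul (hg.cont.comp (by fun_prop) ?_)
    intro x hx
    exact mem_Ici.2 (hpos x hx)
  · refine ⟨convex_Ici _, ?_⟩
    intro x hx y hy p q hp hq hpq
    have := hg.conv.2 (mem_Ici.2 (hpos x hx)) (mem_Ici.2 (hpos y hy)) hp hq hpq
    simp only [smul_eq_mul] at *
    have e : t⁻¹ * (p * x + q * y) = p * (t⁻¹ * x) + q * (t⁻¹ * y) := by ring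
    rw [e]
    nlinarith
  · intro x hx
    exact mul_nonneg ht.le (hg.nonneg _ (hpos x hx))
  · simp only [mul_zero]
    rw [hg.zero]; ring
  · intro x hx
    have := hg.lower _ (hpos x hx)
    calc ν * (t * ω - x) = t * (ν * (ω - t⁻¹ * x)) := by field_simp
      _ ≤ _ := by gcongr
  · refine Integrable.const_mul ?_ t
    have := (integrableOn_Ioi_comp_mul_left_iff g 0 ht').2 (by simpa using hg.intg)
    exact this
  · rw [integral_const_mul, integral_comp_mul_left_Ioi g 0 ht', mul_zero, hg.integral]
    simp only [inv_inv, smul_eq_mul]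
    ring
  · intro x hx y hy hxy
    have := hg.anti (mem_Ici.2 (hpos x hx)) (mem_Ici.2 (hpos y hy))
      (mul_le_mul_of_nonneg_left hxy ht'.le)
    exact mul_le_mul_of_nonneg_left this ht.le

lemma Adm.scale_ge {ν ω ρ t : ℝ} {g : ℝ → ℝ} (hg : Adm ν ω ρ g) (ht : 1 ≤ t) {x : ℝ}
    (hx : 0 ≤ x) : g x ≤ t * g (t⁻¹ * x) := by
  have h1 : t⁻¹ * x ≤ x := by
    have := inv_le_one_of_one_le₀ ht
    nlinarith
  have h0 : 0 ≤ t⁻¹ * x := by positivity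
  have h2 := hg.anti (mem_Ici.2 h0) (mem_Ici.2 hx) h1
  have h3 := hg.nonneg _ h0
  nlinarith

/-! ### Two-point tails are feasible -/

lemma fs_convex {ν p₁ x₁ p₂ x₂ : ℝ} (hν : 0 ≤ ν) (h1 : 0 ≤ p₁) (h2 : 0 ≤ p₂) :
    ConvexOn ℝ univ (fs ν p₁ x₁ p₂ x₂) := by
  have a1 := (ramp_convexOn x₁ univ convex_univ).smul h1
  have a2 := (ramp_convexOn x₂ univ convex_univ).smul h2
  exact (a1.add a2).smul hν

lemma tp_feasible {a βl βu ηl ηu ν ω ρ x : ℝ} (hν : 0 < ν) (h0 : 0 ≤ x) (hx : x < ω)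
    (hρ : ω ^ 2 ≤ ρ) (h1 : ηl ≤ ν * ω) (h2 : ν * ω ≤ ηu) (h3 : βl ≤ ν * ρ / 2)
    (h4 : ν * ρ / 2 ≤ βu) : RFeasible a βl βu ηl ηu ν (fun y => tp ν ω ρ x (y - a)) := by
  set f : ℝ → ℝ := fun y => tp ν ω ρ x (y - a) with hf
  have hp1 : 0 ≤ (ρ - ω ^ 2) / (ρ - 2 * ω * x + x ^ 2) :=
    div_nonneg (by linarith) (tp_pos hx hρ).le
  have hp2 : 0 ≤ (ω - x) ^ 2 / (ρ - 2 * ω * x + x ^ 2) :=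
    div_nonneg (sq_nonneg _) (tp_pos hx hρ).le
  have hx2 := tp_x2 hx hρ
  have hcc : ConvexOn ℝ univ (tp ν ω ρ x) := fs_convex hν.le hp1 hp2
  have hconv : ConvexOn ℝ univ f := by
    refine ⟨convex_univ, ?_⟩
    intro u _ v _ p q hp hq hpq
    have := hcc.2 (mem_univ (u - a)) (mem_univ (v - a)) hp hq hpq
    have e : p • (u - a) + q • (v - a) = p • u + q • v - a := by
      simp only [smul_eq_mul]
      have : q = 1 - p := by linarith
      subst this; ring
    rw [e] at this
    exact this
  have hfa : f a = ν * ω := by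
    simp only [hf, sub_self]
    unfold tp
    rw [fs_low (tp_sum hx hρ) (tp_mean hx hρ) (by linarith) h0]; ring
  have hIntg : ∫ y in Ioi a, f y = ν * ρ / 2 := by
    rw [shift_integral]
    simp only [hf, add_sub_cancel_right]
    unfold tp
    rw [fs_integral _ _ _ h0 (by linarith), tp_sq hx hρ]
  have hcont : Continuous f := by
    have : Continuous (tp ν ω ρ x) := fs_cont _ _ _ _ _
    exact this.comp (by fun_prop)
  have hd : DifferentiableWithinAt ℝ f (Ioi a) a :=
    hconv.differentiableWithinAt_Ioi_of_mem_interior (by simp)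
  refine ⟨?_, by rw [hIntg]; exact h3, by rw [hIntg]; exact h4, by rw [hfa]; exact h1,
    by rw [hfa]; exact h2, hcont.continuousWithinAt, ⟨_, hd.hasDerivWithinAt⟩, ?_,
    hconv.subset (subset_univ _) (convex_Ici _), ?_⟩
  · rw [shift_integrableOn]
    simp only [hf, add_sub_cancel_right]
    exact fs_int _ _ _ _ _
  · have ht := (hasDerivWithinAt_iff_tendsto_slope' self_notMem_Ioi).1 hd.hasDerivWithinAt
    refine ge_of_tendsto ht ?_
    filter_upwards [self_mem_nhdsWithin] with y hy
    have hy' : a < y := hy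
    rw [slope_def_field, le_div_iff₀ (by linarith), hfa]
    have : ν * (ω - (y - a)) ≤ f y := by
      simp only [hf]
      unfold tp fs
      apply mul_le_mul_of_nonneg_left _ hν.le
      have r1 := mul_le_mul_of_nonneg_left (le_ramp x (y - a)) hp1
      have r2 := mul_le_mul_of_nonneg_left (le_ramp ((ρ - ω * x) / (ω - x)) (y - a)) hp2
      have s1 := tp_sum hx hρ
      have s2 := tp_mean hx hρ
      refine le_trans (le_of_eq ?_) (add_le_add r1 r2)
      linear_combination (-1) * s2 + (y - a) * s1
    linarith
  · intro y _
    simp only [hf]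
    unfold tp fs
    have r1 := ramp_nonneg x (y - a)
    have r2 := ramp_nonneg ((ρ - ω * x) / (ω - x)) (y - a)
    positivity

lemma tp_value {a ν lam ω ρ M x : ℝ} {h : ℝ → ℝ} (h0 : 0 ≤ x) (hx : x < ω)
    (hρ : ω ^ 2 ≤ ρ) (hk0 : ∀ x, 0 ≤ h x) (hkM : ∀ x, h x ≤ M)
    (hu : Unimod (fun x => h (x + a))) :
    Wcal a ν lam h x ω ρ = ∫ y in Ioi a, h y * tp ν ω ρ x (y - a) := by
  have k0 : ∀ x, 0 ≤ (fun x => h (x + a)) x := fun x => hk0 _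
  have kM : ∀ x, (fun x => h (x + a)) x ≤ M := fun x => hkM _
  have hH : ∀ y, 0 ≤ y → ∫ x in Ioi 0, h (x + a) * ramp y x = Hfun a h y := fun y hy =>
    integral_mul_ramp a h hy (bdd_intOn k0 kM hu.meas y)
  rw [shift_integral]
  simp only [add_sub_cancel_right]
  have := fs_integral_mul k0 kM hu.meas ν ((ρ - ω ^ 2) / (ρ - 2 * ω * x + x ^ 2)) x
    ((ω - x) ^ 2 / (ρ - 2 * ω * x + x ^ 2)) ((ρ - ω * x) / (ω - x))
  unfold tp
  rw [this, hH x h0, hH _ (by linarith [tp_x2 hx hρ])]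
  unfold Wcal
  rw [if_neg hx.ne]

lemma Hfun_cont {a M : ℝ} {h : ℝ → ℝ} (hk0 : ∀ x, 0 ≤ h x) (hkM : ∀ x, h x ≤ M)
    (hu : Unimod (fun x => h (x + a))) {ω : ℝ} (hω : 0 < ω) : ContinuousAt (Hfun a h) ω := by
  have k0 : ∀ x, 0 ≤ (fun x => h (x + a)) x := fun x => hk0 _
  have kM : ∀ x, (fun x => h (x + a)) x ≤ M := fun x => hkM _
  have hI := bdd_intOn k0 kM hu.meas (ω + 1)
  have hI' : IntervalIntegrable (fun x => h (x + a)) volume 0 (ω + 1) := by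
    rw [intervalIntegrable_iff_integrableOn_Ioc_of_le (by linarith)]; exact hI
  have c1 : ContinuousOn (fun u => ∫ v in (0:ℝ)..u, h (v + a)) (uIcc 0 (ω + 1)) :=
    intervalIntegral.continuousOn_primitive_interval (by
      rw [uIcc_of_le (by linarith), integrableOn_Icc_iff_integrableOn_Ioc]; exact hI)
  have c2 : ContinuousOn (Hfun a h) (uIcc 0 (ω + 1)) :=
    intervalIntegral.continuousOn_primitive_interval (c1.integrableOn_uIcc)
  rw [uIcc_of_le (by linarith)] at c2
  exact c2.continuousAt (Icc_mem_nhds hω (by linarith))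

lemma Wcal_limit {a ν lam ω ρ M : ℝ} {h : ℝ → ℝ} (hω : 0 < ω) (hρ : ω ^ 2 ≤ ρ)
    (hk0 : ∀ x, 0 ≤ h x) (hkM : ∀ x, h x ≤ M) (hu : Unimod (fun x => h (x + a)))
    (hlam : Tendsto (fun x => Hfun a h x / x ^ 2) atTop (𝓝 lam)) :
    Tendsto (fun x => Wcal a ν lam h x ω ρ) (𝓝[<] ω) (𝓝 (Wcal a ν lam h ω ω ρ)) := by
  rcases hρ.eq_or_lt with heq | hlt
  · refine tendsto_const_nhds.congr' ?_
    filter_upwards [self_mem_nhdsWithin] with x hx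
    have hx' : x < ω := hx
    have h2 : ω - x ≠ 0 := (sub_pos.2 hx').ne'
    unfold Wcal
    rw [if_pos rfl, if_neg hx'.ne, ← heq]
    have e1 : (ω ^ 2 - ω * x) / (ω - x) = ω := by field_simp
    have e2 : ω ^ 2 - 2 * ω * x + x ^ 2 = (ω - x) ^ 2 := by ring
    rw [e1, e2]
    have e3 : (ω - x) ^ 2 / (ω - x) ^ 2 = 1 := div_self (pow_ne_zero 2 h2)
    rw [e3]; simp
  · have hd : 0 < ρ - ω ^ 2 := by linarith
    have hq : ∀ x, 0 < ρ - 2 * ω * x + x ^ 2 := by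
      intro x; nlinarith [sq_nonneg (ω - x)]
    have hid : Tendsto (fun x : ℝ => x) (𝓝[<] ω) (𝓝 ω) := tendsto_nhdsWithin_of_tendsto_nhds tendsto_id
    have t1 : Tendsto (fun x => (ρ - ω ^ 2) / (ρ - 2 * ω * x + x ^ 2)) (𝓝[<] ω)
        (𝓝 ((ρ - ω ^ 2) / (ρ - 2 * ω * ω + ω ^ 2))) :=
      tendsto_const_nhds.div ((tendsto_const_nhds.sub (hid.const_mul _)).add (hid.pow 2)) (hq ω).ne'
    have t2 : Tendsto (fun x => Hfun a h x) (𝓝[<] ω) (𝓝 (Hfun a h ω)) :=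
      (Hfun_cont hk0 hkM hu hω).tendsto.comp hid
    have t3 : Tendsto (fun x => (ρ - ω * x) / (ω - x)) (𝓝[<] ω) atTop := by
      have z : Tendsto (fun x => ω - x) (𝓝[<] ω) (𝓝[>] 0) := by
        rw [tendsto_nhdsWithin_iff]
        constructor
        · have := (tendsto_const_nhds (x := ω)).sub hid
          simpa using this
        · filter_upwards [self_mem_nhdsWithin] with x hx
          exact mem_Ioi.2 (sub_pos.2 (mem_Iio.1 hx))
      have z2 := tendsto_inv_nhdsGT_zero.comp z
      have z3 : Tendsto (fun x => ρ - ω * x) (𝓝[<] ω) (𝓝 (ρ - ω * ω)) :=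
        tendsto_const_nhds.sub (hid.const_mul _)
      exact z3.pos_mul_atTop (by nlinarith) z2
    have t4 := hlam.comp t3
    have t5 : Tendsto (fun x => (ρ - ω * x) ^ 2 / (ρ - 2 * ω * x + x ^ 2)) (𝓝[<] ω)
        (𝓝 ((ρ - ω * ω) ^ 2 / (ρ - 2 * ω * ω + ω ^ 2))) :=
      ((tendsto_const_nhds.sub (hid.const_mul _)).pow 2).div
        ((tendsto_const_nhds.sub (hid.const_mul _)).add (hid.pow 2)) (hq ω).ne'
    have t6 := ((t1.mul t2).add (t5.mul t4)).const_mul ν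
    have e : ν * ((ρ - ω ^ 2) / (ρ - 2 * ω * ω + ω ^ 2) * Hfun a h ω +
        (ρ - ω * ω) ^ 2 / (ρ - 2 * ω * ω + ω ^ 2) * lam) = Wcal a ν lam h ω ω ρ := by
      unfold Wcal
      rw [if_pos rfl]
      have e1 : ρ - 2 * ω * ω + ω ^ 2 = ρ - ω ^ 2 := by ring
      have e2 : ρ - ω * ω = ρ - ω ^ 2 := by ring
      rw [e1, e2]
      have e3 : (ρ - ω ^ 2) ^ 2 / (ρ - ω ^ 2) = ρ - ω ^ 2 := by
        rw [pow_two, mul_div_assoc, div_self hd.ne', mul_one]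
      rw [e3, div_self hd.ne']
      ring
    rw [e] at t6
    refine t6.congr' ?_
    filter_upwards [self_mem_nhdsWithin, t3.eventually_gt_atTop 0] with x hx hx2
    have hx' : x < ω := hx
    have h2 : ω - x ≠ 0 := (sub_pos.2 hx').ne'
    unfold Wcal
    rw [if_neg hx'.ne]
    simp only [Function.comp]
    have e4 := tp_shift (c := 0) hx' hρ
    simp only [zero_mul, sub_zero] at e4
    rw [← e4]
    congr 2
    set X := (ρ - ω * x) / (ω - x)
    field_simp
/-- Theorem: the optimal value of the relaxed worst-case tail problem is obtained by
two low-dimensional nonlinear programs. -/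
theorem relaxed_value_eq_two_dim_search
    (a βl βu ηl ηu ν : ℝ)
    (hβl : 0 < βl) (hβ : βl ≤ βu) (hηl : 0 < ηl) (hη : ηl ≤ ηu) (hν : 0 < ν)
    (hcond : ηl ^ 2 < 2 * βu * ν)
    (h : ℝ → ℝ) (hbd : ∃ M, ∀ x, |h x| ≤ M) (hpos : ∀ x, 0 ≤ h x)
    (hquasi : ∃ c : EReal, (a : EReal) ≤ c ∧
      MonotoneOn h {x : ℝ | a ≤ x ∧ (x : EReal) < c} ∧
      AntitoneOn h {x : ℝ | c < (x : EReal)})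
    (lam : ℝ) (hlam : Tendsto (fun x => Hfun a h x / x ^ 2) atTop (𝓝 lam))
    (μl μu σl σu : ℝ)
    (hμl : μl = ηl / ν) (hμu : μu = ηu / ν) (hσl : σl = 2 * βl / ν) (hσu : σu = 2 * βu / ν) :
    sSup {z : ℝ | ∃ f : ℝ → ℝ, RFeasible a βl βu ηl ηu ν f ∧
      z = ∫ x in Set.Ioi a, h x * f x} =
    max
      (sSup {z : ℝ | ∃ ρ ∈ Set.Icc (max σl (μu ^ 2)) σu, ∃ x₁ ∈ Set.Icc (0:ℝ) μu,
        z = Wcal a ν lam h x₁ μu ρ})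
      (sSup {z : ℝ | ∃ ω ∈ Set.Icc μl (min μu (Real.sqrt σu)), ∃ x₁ ∈ Set.Icc (0:ℝ) ω,
        z = Wcal a ν lam h x₁ ω σu}) := by
  have hu := unimod_of hquasi
  obtain ⟨M, hM⟩ := hbd
  have hkM : ∀ x, h x ≤ M := fun x => (le_abs_self _).trans (hM x)
  have hM0 : 0 ≤ M := (abs_nonneg _).trans (hM 0)
  have hβu : 0 < βu := by linarith
  have hηu : 0 < ηu := by linarith
  have pμl : 0 < μl := by rw [hμl]; positivity
  have pμu : 0 < μu := by rw [hμu]; positivity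
  have pσl : 0 < σl := by rw [hσl]; positivity
  have pσu : 0 < σu := by rw [hσu]; positivity
  have eμl : ν * μl = ηl := by rw [hμl]; field_simp
  have eμu : ν * μu = ηu := by rw [hμu]; field_simp
  have eσl : ν * σl = 2 * βl := by rw [hσl]; field_simp
  have eσu : ν * σu = 2 * βu := by rw [hσu]; field_simp
  have hμlu : μl ≤ μu := le_of_mul_le_mul_left (by rw [eμl, eμu]; exact hη) hν
  have hμσ : μl ^ 2 ≤ σu := by
    have : ν ^ 2 * μl ^ 2 ≤ ν ^ 2 * σu := by
      calc ν ^ 2 * μl ^ 2 = (ν * μl) ^ 2 := by ring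
        _ ≤ 2 * βu * ν := by rw [eμl]; exact hcond.le
        _ = ν * (ν * σu) := by rw [eσu]; ring
        _ = _ := by ring
    exact le_of_mul_le_mul_left this (by positivity)
  set S : Set ℝ := {z : ℝ | ∃ f : ℝ → ℝ, RFeasible a βl βu ηl ηu ν f ∧
      z = ∫ x in Set.Ioi a, h x * f x} with hS
  set S1 : Set ℝ := {z : ℝ | ∃ ρ ∈ Set.Icc (max σl (μu ^ 2)) σu, ∃ x₁ ∈ Set.Icc (0:ℝ) μu,
        z = Wcal a ν lam h x₁ μu ρ} with hS1
  set S2 : Set ℝ := {z : ℝ | ∃ ω ∈ Set.Icc μl (min μu (Real.sqrt σu)), ∃ x₁ ∈ Set.Icc (0:ℝ) ω,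
        z = Wcal a ν lam h x₁ ω σu} with hS2
  have hSb : BddAbove S := by
    refine ⟨M * βu, ?_⟩
    rintro z ⟨f, hf, rfl⟩
    have hA := adm_of_feasible hν hf
    rw [shift_integral]
    have i1 : IntegrableOn (fun x => h (x + a) * f (x + a)) (Ioi 0) :=
      bdd_mul_int (k := fun x => h (x + a)) (fun x => hpos _) (fun x => hkM _) hu.meas hA.intg
    calc ∫ x in Ioi 0, h (x + a) * f (x + a) ≤ ∫ x in Ioi 0, M * f (x + a) :=
          setIntegral_mono_on i1 (hA.intg.const_mul M) measurableSet_Ioi (fun x hx =>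
            mul_le_mul_of_nonneg_right (hkM _) (hA.nonneg x (le_of_lt hx)))
      _ = M * ∫ x in Ioi a, f x := by rw [integral_const_mul, ← shift_integral]
      _ ≤ M * βu := mul_le_mul_of_nonneg_left hf.2.2.1 hM0
  have hS0 : 0 ≤ sSup S := by
    apply Real.sSup_nonneg
    rintro z ⟨f, hf, rfl⟩
    obtain ⟨-, -, -, -, -, -, -, -, -, hnn⟩ := hf
    exact setIntegral_nonneg measurableSet_Ioi (fun x hx =>
      mul_nonneg (hpos _) (hnn x (le_of_lt hx)))
  have lower : ∀ ω ρ x, 0 < ω → ω ^ 2 ≤ ρ → ηl ≤ ν * ω → ν * ω ≤ ηu → βl ≤ ν * ρ / 2 →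
      ν * ρ / 2 ≤ βu → 0 ≤ x → x ≤ ω → Wcal a ν lam h x ω ρ ≤ sSup S := by
    intro ω ρ x hω hρ h1 h2 h3 h4 h0 hx
    have key : ∀ y, 0 ≤ y → y < ω → Wcal a ν lam h y ω ρ ≤ sSup S := by
      intro y hy0 hy
      exact le_csSup hSb ⟨_, tp_feasible hν hy0 hy hρ h1 h2 h3 h4,
        tp_value hy0 hy hρ hpos hkM hu⟩
    rcases hx.eq_or_lt with rfl | hlt
    · refine le_of_tendsto (Wcal_limit hω hρ hpos hkM hu hlam) ?_
      filter_upwards [Ioo_mem_nhdsLT hω] with y hy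
      exact key y hy.1.le hy.2
    · exact key x h0 hlt
  have b1 : ∀ z ∈ S1, z ≤ sSup S := by
    rintro z ⟨ρ, ⟨hρ1, hρ2⟩, x, ⟨hx0, hx⟩, rfl⟩
    have r1 := (le_max_left _ _).trans hρ1
    have r2 := (le_max_right _ _).trans hρ1
    have m1 := mul_le_mul_of_nonneg_left r1 hν.le
    have m2 := mul_le_mul_of_nonneg_left hρ2 hν.le
    exact lower _ _ _ pμu r2 (by linarith) (by linarith) (by linarith) (by linarith) hx0 hx
  have b2 : ∀ z ∈ S2, z ≤ sSup S := by
    rintro z ⟨ω, ⟨hω1, hω2⟩, x, ⟨hx0, hx⟩, rfl⟩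
    have r1 := hω2.trans (min_le_left _ _)
    have r2 := hω2.trans (min_le_right _ _)
    have hω : 0 < ω := by linarith
    have m1 := mul_le_mul_of_nonneg_left hω1 hν.le
    have m2 := mul_le_mul_of_nonneg_left r1 hν.le
    exact lower _ _ _ hω ((Real.le_sqrt hω.le pσu.le).1 r2) (by linarith) (by linarith)
      (by linarith) (by linarith) hx0 hx
  apply le_antisymm
  · apply csSup_le
    · have m := mul_le_mul_of_nonneg_left hμlu hν.le
      exact ⟨_, _, tp_feasible (x := 0) (ω := μl) (ρ := σu) hν le_rfl pμl hμσ (by linarith)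
        (by linarith) (by linarith) (by linarith), rfl⟩
    · rintro z ⟨f, hf, rfl⟩
      have hA := adm_of_feasible hν hf
      obtain ⟨-, f1, f2, f3, f4, -⟩ := hf
      set ω := f a / ν with hω
      set ρ := 2 * (∫ x in Ioi a, f x) / ν with hρ
      have eω : ν * ω = f a := by rw [hω]; field_simp
      have eρ : ν * ρ = 2 * (∫ x in Ioi a, f x) := by rw [hρ]; field_simp
      have w1 : μl ≤ ω := le_of_mul_le_mul_left (by linarith) hν
      have w2 : ω ≤ μu := le_of_mul_le_mul_left (by linarith) hν
      have w3 : σl ≤ ρ := le_of_mul_le_mul_left (by linarith) hν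
      have w4 : ρ ≤ σu := le_of_mul_le_mul_left (by linarith) hν
      have pω : 0 < ω := by linarith
      have pρ : 0 < ρ := by linarith
      clear_value ω ρ
      have main : ∀ t, 1 ≤ t → ∃ x₁ ∈ Icc (0:ℝ) (t * ω), (t * ω) ^ 2 ≤ t ^ 2 * ρ ∧
          ∫ x in Ioi a, h x * f x ≤ Wcal a ν lam h x₁ (t * ω) (t ^ 2 * ρ) := by
        intro t ht
        have ht0 : 0 < t := by linarith
        have hB := hA.scale ht0
        obtain ⟨x₁, hx₁, hle⟩ := upper_Wcal hν (mul_pos ht0 pω) hpos hkM hu hlam hB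
        refine ⟨x₁, hx₁, hB.sq_le hν (mul_pos ht0 pω).le, le_trans ?_ hle⟩
        rw [shift_integral]
        have i1 : IntegrableOn (fun x => h (x + a) * f (x + a)) (Ioi 0) :=
          bdd_mul_int (k := fun x => h (x + a)) (fun x => hpos _) (fun x => hkM _) hu.meas hA.intg
        have i2 := bdd_mul_int (k := fun x => h (x + a)) (fun x => hpos _) (fun x => hkM _)
          hu.meas hB.intg
        exact setIntegral_mono_on i1 i2 measurableSet_Ioi (fun x hx =>
          mul_le_mul_of_nonneg_left (hA.scale_ge ht (le_of_lt hx)) (hpos _))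
      have t1 : 1 ≤ μu / ω := by rw [le_div_iff₀ pω]; linarith
      have t2 : 1 ≤ Real.sqrt (σu / ρ) := by
        rw [Real.one_le_sqrt, le_div_iff₀ pρ]; linarith
      have q1 : μu / ω * ω = μu := by field_simp
      have q2 : Real.sqrt (σu / ρ) ^ 2 * ρ = σu := by
        rw [Real.sq_sqrt (by positivity)]; field_simp
      rcases le_total (μu / ω) (Real.sqrt (σu / ρ)) with hc | hc
      · obtain ⟨x₁, hx₁, hs, hle⟩ := main _ t1
        rw [q1] at hx₁ hs hle
        refine le_trans (le_trans hle (le_csSup ⟨_, b1⟩ ?_)) (le_max_left _ _)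
        refine ⟨_, ⟨max_le ?_ hs, ?_⟩, x₁, hx₁, rfl⟩
        · have : 1 ≤ (μu / ω) ^ 2 := one_le_pow₀ t1
          nlinarith
        · rw [← q2]
          gcongr
      · obtain ⟨x₁, hx₁, hs, hle⟩ := main _ t2
        rw [q2] at hs hle
        refine le_trans (le_trans hle (le_csSup ⟨_, b2⟩ ?_)) (le_max_right _ _)
        refine ⟨_, ⟨?_, le_min ?_ (Real.le_sqrt_of_sq_le hs)⟩, x₁, hx₁, rfl⟩
        · nlinarith
        · have := mul_le_mul_of_nonneg_right hc pω.le
          linarith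
  · exact max_le (Real.sSup_le b1 hS0) (Real.sSup_le b2 hS0)
end
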